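/- arXiv:1312.2476 — 2 statements merged into one kernel-verified Lean document; each statement's English description precedes it below -/
import Mathlib

section
/- Let 0 < γ ≤ α. There exists a positive constant C such that |(f(∂,γ)Z_t)(x)| ≤ C · (t^{1/(2α)} + ‖x‖_p)^{−2γ−4} for all x ∈ ℚ_p⁴ and all t > 0. -/
open MeasureTheory Real Filter Set

noncomputable section

namespace PadicParabolic

variable (p : ℕ) [Fact p.Prime]

instance : MeasurableSpace ℚ_[p] := borel _
instance : BorelSpace ℚ_[p] := ⟨rfl⟩

/-- The four dimensional vector space over `ℚ_[p]`, with the max-norm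
`‖x‖ = max_{1 ≤ i ≤ 4} |x_i|_p`. -/
abbrev V (p : ℕ) [Fact p.Prime] := Fin 4 → ℚ_[p]

/-- `a` is a quadratic non-residue modulo `p`. -/
def IsQNR (a : ℤ) : Prop := ∀ b : ZMod p, b ^ 2 ≠ (a : ZMod p)

/-- The elliptic quadratic form `f(x) = x₁² − a x₂² − p x₃² + a p x₄²`. -/
def qf (a : ℤ) (x : V p) : ℚ_[p] :=
  x 0 ^ 2 - (a : ℚ_[p]) * x 1 ^ 2 - (p : ℚ_[p]) * x 2 ^ 2 + (a : ℚ_[p]) * (p : ℚ_[p]) * x 3 ^ 2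

/-- The dual elliptic quadratic form `f°(ξ) = a p ξ₁² − p ξ₂² − a ξ₃² + ξ₄²`. -/
def qfc (a : ℤ) (x : V p) : ℚ_[p] :=
  (a : ℚ_[p]) * (p : ℚ_[p]) * x 0 ^ 2 - (p : ℚ_[p]) * x 1 ^ 2 - (a : ℚ_[p]) * x 2 ^ 2 + x 3 ^ 2

/-- `χ` is the standard additive character `χ(y) = exp(2πi {y}_p)` of `ℚ_p`, characterized as
the unique continuous function with `χ(m/pⁿ) = exp(2πi m/pⁿ)`. -/
def IsStdChar (χ : ℚ_[p] → ℂ) : Prop :=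
  Continuous χ ∧ ∀ (m : ℤ) (n : ℕ),
    χ ((m : ℚ_[p]) / (p : ℚ_[p]) ^ n) =
      Complex.exp (2 * (Real.pi : ℂ) * Complex.I * (m : ℂ) / (p : ℂ) ^ n)

/-- The heat kernel `Z(x,t) = ∫_{ℚ_p⁴} χ(ξ·x) e^{−κ t |f°(ξ)|_p^α} d⁴ξ`. -/
def heatZ (μ : Measure (V p)) (χ : ℚ_[p] → ℂ) (a : ℤ) (κ α : ℝ) (x : V p) (t : ℝ) : ℂ :=
  ∫ ξ, χ (∑ i, ξ i * x i) * (Real.exp (-(κ * t * ‖qfc p a ξ‖ ^ α)) : ℂ) ∂μ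

/-- The pseudodifferential operator
`(f(∂,γ)φ)(x) = ((1 − p^γ)/(1 − p^{−γ−2})) ∫ (φ(x−y) − φ(x)) |f(y)|_p^{−γ−2} d⁴y`. -/
def fop (μ : Measure (V p)) (a : ℤ) (γ : ℝ) (φ : V p → ℂ) (x : V p) : ℂ :=
  (((1 - (p : ℝ) ^ γ) / (1 - (p : ℝ) ^ (-γ - 2)) : ℝ) : ℂ) *
    ∫ y, (φ (x - y) - φ x) * ((‖qf p a y‖ ^ (-γ - 2) : ℝ) : ℂ) ∂μ

/-- Membership in the domain of `f(∂,γ)`: `φ` is locally constant and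
`∫_{‖x‖_p ≥ p^m} |φ(x)| |f(x)|_p^{−γ−2} d⁴x < ∞` for some `m ∈ ℤ`. -/
def InDomain (μ : Measure (V p)) (a : ℤ) (γ : ℝ) (φ : V p → ℂ) : Prop :=
  IsLocallyConstant φ ∧ ∃ m : ℤ,
    IntegrableOn (fun x => ‖φ x‖ * ‖qf p a x‖ ^ (-γ - 2)) {x : V p | (p : ℝ) ^ m ≤ ‖x‖} μ

variable {p}

lemma IsQNR.norm_intCast {a : ℤ} (ha : IsQNR p a) : ‖(a : ℚ_[p])‖ = 1 := by
  refine le_antisymm (Padic.norm_int_le_one a) (not_lt.1 fun h => ?_)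
  rw [Padic.norm_intCast_lt_one_iff] at h
  have h0 := (ZMod.intCast_zmod_eq_zero_iff_dvd a p).2 h
  exact ha 0 (by simp [h0])

lemma IsQNR.norm_sq_sub {a : ℤ} (ha : IsQNR p a) (w : ℤ_[p]) :
    ‖w ^ 2 - (a : ℤ_[p])‖ = 1 := by
  refine le_antisymm (PadicInt.norm_le_one _) (not_lt.1 fun h => ?_)
  rw [← PadicInt.mem_nonunits, ← IsLocalRing.mem_maximalIdeal, ← PadicInt.ker_toZMod,
    RingHom.mem_ker, map_sub, map_pow, map_intCast, sub_eq_zero] at h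
  exact ha _ h

lemma IsQNR.norm_binary {a : ℤ} (ha : IsQNR p a) (u v : ℚ_[p]) :
    ‖u ^ 2 - (a : ℚ_[p]) * v ^ 2‖ = max (‖u‖ ^ 2) (‖v‖ ^ 2) := by
  have hv : ‖(a : ℚ_[p]) * v ^ 2‖ = ‖v‖ ^ 2 := by rw [norm_mul, ha.norm_intCast, norm_pow, one_mul]
  by_cases h : ‖u‖ = ‖v‖
  · rw [h, max_self]
    by_cases hv0 : v = 0
    · have hu0 : u = 0 := by simpa [hv0] using h
      simp [hv0, hu0]
    have hv0' : ‖v‖ ≠ 0 := norm_ne_zero_iff.2 hv0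
    have hw : ‖u / v‖ ≤ 1 := by rw [norm_div, h, div_self hv0']
    obtain ⟨w, hw'⟩ : ∃ w : ℤ_[p], (w : ℚ_[p]) = u / v := ⟨⟨u / v, hw⟩, rfl⟩
    have h1 := ha.norm_sq_sub w
    rw [PadicInt.norm_def, PadicInt.coe_sub, PadicInt.coe_pow, PadicInt.coe_intCast, hw'] at h1
    have : u ^ 2 - (a : ℚ_[p]) * v ^ 2 = ((u / v) ^ 2 - a) * v ^ 2 := by field_simp
    rw [this, norm_mul, h1, one_mul, norm_pow]
  · have h2 : ‖u ^ 2‖ ≠ ‖-((a : ℚ_[p]) * v ^ 2)‖ := by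
      rw [norm_neg, hv, norm_pow]
      exact fun h' => h ((pow_left_inj₀ (norm_nonneg _) (norm_nonneg _) two_ne_zero).1 h')
    rw [sub_eq_add_neg, Padic.add_eq_max_of_ne h2, norm_neg, hv, norm_pow]

lemma pos_prime : (0 : ℝ) < p := mod_cast (Fact.out : p.Prime).pos

lemma one_lt_prime : (1 : ℝ) < p := mod_cast (Fact.out : p.Prime).one_lt

lemma exists_norm_eq_zpow {x : ℚ_[p]} (hx : x ≠ 0) : ∃ n : ℤ, ‖x‖ = (p : ℝ) ^ n :=
  ⟨_, Padic.norm_eq_zpow_neg_valuation hx⟩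

lemma norm_sq_ne_mul_norm_sq {x y : ℚ_[p]} (hx : x ≠ 0) :
    ‖x‖ ^ 2 ≠ (p : ℝ)⁻¹ * ‖y‖ ^ 2 := by
  intro h
  have hy : y ≠ 0 := by
    rintro rfl
    simp [hx] at h
  obtain ⟨n, hn⟩ := exists_norm_eq_zpow hx
  obtain ⟨m, hm⟩ := exists_norm_eq_zpow hy
  rw [hn, hm, ← zpow_natCast, ← zpow_mul, ← zpow_natCast, ← zpow_mul, ← zpow_neg_one,
    ← zpow_add₀ pos_prime.ne'] at h
  have := zpow_right_injective₀ pos_prime one_lt_prime.ne' h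
  push_cast at this
  omega

variable (p) in
/-- The diagonal weights for which `|f(x)|_p = max_i wt i * |x_i|_p ^ 2`. -/
def wt (i : Fin 4) : ℝ := if i < 2 then 1 else (p : ℝ)⁻¹

lemma norm_qf_eq {a : ℤ} (ha : IsQNR p a) (x : V p) :
    ‖qf p a x‖ = max (max (‖x 0‖ ^ 2) (‖x 1‖ ^ 2))
      ((p : ℝ)⁻¹ * max (‖x 2‖ ^ 2) (‖x 3‖ ^ 2)) := by
  have hsplit : qf p a x = (x 0 ^ 2 - (a : ℚ_[p]) * x 1 ^ 2) +
      -((p : ℚ_[p]) * (x 2 ^ 2 - (a : ℚ_[p]) * x 3 ^ 2)) := by rw [qf]; ring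
  have h2 : ‖-((p : ℚ_[p]) * (x 2 ^ 2 - (a : ℚ_[p]) * x 3 ^ 2))‖ =
      (p : ℝ)⁻¹ * max (‖x 2‖ ^ 2) (‖x 3‖ ^ 2) := by
    rw [norm_neg, norm_mul, Padic.norm_p, ha.norm_binary]
  rw [← ha.norm_binary (x 0), ← h2, hsplit]
  by_cases h : x 0 ^ 2 - (a : ℚ_[p]) * x 1 ^ 2 = 0
  · simp [h, mul_nonneg (inv_nonneg.2 pos_prime.le)]
  refine Padic.add_eq_max_of_ne fun h' => ?_
  have key : ∀ u v : ℚ_[p], ∃ w : ℚ_[p], max (‖u‖ ^ 2) (‖v‖ ^ 2) = ‖w‖ ^ 2 := fun u v => by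
    rcases max_choice (‖u‖ ^ 2) (‖v‖ ^ 2) with h | h
    exacts [⟨u, h⟩, ⟨v, h⟩]
  obtain ⟨w, hw⟩ := key (x 0) (x 1)
  obtain ⟨z, hz⟩ := key (x 2) (x 3)
  rw [h2, ha.norm_binary, hw, hz] at h'
  refine norm_sq_ne_mul_norm_sq (fun hw0 => h ?_) h'
  rw [← norm_eq_zero, ha.norm_binary, hw, hw0, norm_zero, zero_pow two_ne_zero]

lemma norm_qf_le_iff {a : ℤ} (ha : IsQNR p a) {x : V p} {r : ℝ} :
    ‖qf p a x‖ ≤ r ↔ ∀ i, wt p i * ‖x i‖ ^ 2 ≤ r := by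
  rw [norm_qf_eq ha, mul_max_of_nonneg _ _ (inv_nonneg.2 pos_prime.le)]
  simp [Fin.forall_fin_succ, wt, Fin.lt_def, and_assoc]

lemma qfc_eq_qf_rev (a : ℤ) (x : V p) : qfc p a x = qf p a (x ∘ Fin.rev) := by
  have h0 : Fin.rev (0 : Fin 4) = 3 := rfl
  have h1 : Fin.rev (1 : Fin 4) = 2 := rfl
  have h2 : Fin.rev (2 : Fin 4) = 1 := rfl
  have h3 : Fin.rev (3 : Fin 4) = 0 := rfl
  simp only [qf, qfc, Function.comp, h0, h1, h2, h3]
  ring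

lemma norm_qfc_le_iff {a : ℤ} (ha : IsQNR p a) {x : V p} {r : ℝ} :
    ‖qfc p a x‖ ≤ r ↔ ∀ i, wt p i.rev * ‖x i‖ ^ 2 ≤ r := by
  rw [qfc_eq_qf_rev, norm_qf_le_iff ha, ← Fin.revPerm.forall_congr_right]
  simp

omit [Fact p.Prime] in
lemma wt_mul_wt_rev (i : Fin 4) : wt p i * wt p i.rev = (p : ℝ)⁻¹ := by
  fin_cases i <;> simp [wt, Fin.lt_def, Fin.rev]

lemma inv_le_wt (i : Fin 4) : (p : ℝ)⁻¹ ≤ wt p i := by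
  rw [wt]
  split_ifs
  exacts [inv_le_one_of_one_le₀ one_lt_prime.le, le_rfl]

lemma wt_pos (i : Fin 4) : 0 < wt p i := (inv_pos.2 pos_prime).trans_le (inv_le_wt i)

lemma norm_add_sq_le {x y : ℚ_[p]} {c r : ℝ} (hc : 0 ≤ c) (hx : c * ‖x‖ ^ 2 ≤ r)
    (hy : c * ‖y‖ ^ 2 ≤ r) : c * ‖x + y‖ ^ 2 ≤ r := by
  rcases le_max_iff.1 (Padic.nonarchimedean x y) with h | h
  · exact le_trans (by gcongr) hx
  · exact le_trans (by gcongr) hy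

lemma norm_qf_add_le {a : ℤ} (ha : IsQNR p a) {x y : V p} {r : ℝ} (hx : ‖qf p a x‖ ≤ r)
    (hy : ‖qf p a y‖ ≤ r) : ‖qf p a (x + y)‖ ≤ r := by
  rw [norm_qf_le_iff ha] at *
  exact fun i => norm_add_sq_le (wt_pos i).le (hx i) (hy i)

lemma norm_qfc_add_le {a : ℤ} (ha : IsQNR p a) {x y : V p} {r : ℝ} (hx : ‖qfc p a x‖ ≤ r)
    (hy : ‖qfc p a y‖ ≤ r) : ‖qfc p a (x + y)‖ ≤ r := by
  rw [norm_qfc_le_iff ha] at *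
  exact fun i => norm_add_sq_le (wt_pos _).le (hx i) (hy i)

lemma qf_neg (a : ℤ) (x : V p) : qf p a (-x) = qf p a x := by simp [qf]

lemma qfc_neg (a : ℤ) (x : V p) : qfc p a (-x) = qfc p a x := by simp [qfc]

lemma norm_qf_sub_le {a : ℤ} (ha : IsQNR p a) {x y : V p} {r : ℝ} (hx : ‖qf p a x‖ ≤ r)
    (hy : ‖qf p a y‖ ≤ r) : ‖qf p a (x - y)‖ ≤ r := by
  rw [sub_eq_add_neg]
  exact norm_qf_add_le ha hx (by rwa [qf_neg])

lemma norm_sq_le_of_forall {w : Fin 4 → ℝ} (hw : ∀ i, (p : ℝ)⁻¹ ≤ w i) {x : V p} {r : ℝ}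
    (hr : 0 ≤ r) (h : ∀ i, w i * ‖x i‖ ^ 2 ≤ r) : ‖x‖ ^ 2 ≤ p * r := by
  have hpr : 0 ≤ p * r := mul_nonneg pos_prime.le hr
  rw [← Real.le_sqrt (norm_nonneg _) hpr, pi_norm_le_iff_of_nonneg (Real.sqrt_nonneg _)]
  intro i
  rw [Real.le_sqrt (norm_nonneg _) hpr]
  have h1 : (p : ℝ)⁻¹ * ‖x i‖ ^ 2 ≤ r :=
    (mul_le_mul_of_nonneg_right (hw i) (by positivity)).trans (h i)
  rwa [inv_mul_le_iff₀ pos_prime] at h1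

lemma norm_sq_le_mul_norm_qf {a : ℤ} (ha : IsQNR p a) (x : V p) :
    ‖x‖ ^ 2 ≤ p * ‖qf p a x‖ :=
  norm_sq_le_of_forall inv_le_wt (norm_nonneg _) ((norm_qf_le_iff ha).1 le_rfl)

lemma norm_sq_le_mul_norm_qfc {a : ℤ} (ha : IsQNR p a) (x : V p) :
    ‖x‖ ^ 2 ≤ p * ‖qfc p a x‖ :=
  norm_sq_le_of_forall (fun i => inv_le_wt i.rev) (norm_nonneg _) ((norm_qfc_le_iff ha).1 le_rfl)

lemma continuous_qf (a : ℤ) : Continuous (qf p a) := by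
  unfold qf
  fun_prop

lemma continuous_qfc (a : ℤ) : Continuous (qfc p a) := by
  unfold qfc
  fun_prop

lemma exists_padicInt_div (x : ℚ_[p]) : ∃ n : ℕ, ∀ m, n ≤ m →
    ∃ z : ℤ_[p], x = (z : ℚ_[p]) / (p : ℚ_[p]) ^ m := by
  have hp0 : (p : ℚ_[p]) ≠ 0 := mod_cast (Fact.out : p.Prime).ne_zero
  obtain ⟨n, hn⟩ := pow_unbounded_of_one_lt ‖x‖ (one_lt_prime (p := p))
  refine ⟨n, fun m hm => ⟨⟨x * (p : ℚ_[p]) ^ m, ?_⟩, ?_⟩⟩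
  · rw [norm_mul, norm_pow, Padic.norm_p, inv_pow, ← div_eq_mul_inv,
      div_le_one (pow_pos pos_prime m)]
    exact hn.le.trans (pow_le_pow_right₀ one_lt_prime.le hm)
  · exact (mul_div_cancel_right₀ x (pow_ne_zero m hp0)).symm

namespace IsStdChar

variable {χ : ℚ_[p] → ℂ}

lemma continuous_div (hχ : IsStdChar p χ) (n : ℕ) :
    Continuous fun z : ℤ_[p] => χ ((z : ℚ_[p]) / (p : ℚ_[p]) ^ n) :=
  hχ.1.comp (continuous_subtype_val.div_const _)

lemma map_add (hχ : IsStdChar p χ) (x y : ℚ_[p]) : χ (x + y) = χ x * χ y := by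
  obtain ⟨n, hn⟩ := exists_padicInt_div x
  obtain ⟨m, hm⟩ := exists_padicInt_div y
  obtain ⟨z, rfl⟩ := hn (max n m) (le_max_left _ _)
  obtain ⟨w, rfl⟩ := hm (max n m) (le_max_right _ _)
  generalize max n m = k
  refine PadicInt.denseRange_intCast.induction_on₂ (p := fun z w : ℤ_[p] =>
    χ ((z : ℚ_[p]) / (p : ℚ_[p]) ^ k + (w : ℚ_[p]) / (p : ℚ_[p]) ^ k) =
      χ ((z : ℚ_[p]) / (p : ℚ_[p]) ^ k) * χ ((w : ℚ_[p]) / (p : ℚ_[p]) ^ k)) ?_ ?_ z w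
  · refine isClosed_eq (hχ.1.comp ?_) ?_
    · exact ((continuous_subtype_val.comp continuous_fst).div_const _).add
        ((continuous_subtype_val.comp continuous_snd).div_const _)
    · exact ((hχ.continuous_div k).comp continuous_fst).mul
        ((hχ.continuous_div k).comp continuous_snd)
  · intro a b
    rw [PadicInt.coe_intCast, PadicInt.coe_intCast, ← add_div, ← Int.cast_add, hχ.2, hχ.2, hχ.2,
      ← Complex.exp_add]
    congr 1
    push_cast
    ring

lemma norm_eq_one (hχ : IsStdChar p χ) (x : ℚ_[p]) : ‖χ x‖ = 1 := by
  obtain ⟨n, hn⟩ := exists_padicInt_div x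
  obtain ⟨z, rfl⟩ := hn n le_rfl
  refine PadicInt.denseRange_intCast.induction_on (p := fun z : ℤ_[p] =>
    ‖χ ((z : ℚ_[p]) / (p : ℚ_[p]) ^ n)‖ = 1) z
    (isClosed_eq (hχ.continuous_div n).norm continuous_const) fun b => ?_
  rw [PadicInt.coe_intCast, hχ.2]
  have : (2 * (Real.pi : ℂ) * Complex.I * (b : ℂ) / (p : ℂ) ^ n) =
      ((2 * Real.pi * b / (p : ℝ) ^ n : ℝ) : ℂ) * Complex.I := by
    push_cast
    ring
  rw [this, Complex.norm_exp_ofReal_mul_I]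

lemma eq_one_of_norm_le_one (hχ : IsStdChar p χ) {x : ℚ_[p]} (hx : ‖x‖ ≤ 1) : χ x = 1 := by
  refine PadicInt.denseRange_intCast.induction_on (p := fun z : ℤ_[p] => χ (z : ℚ_[p]) = 1)
    (⟨x, hx⟩ : ℤ_[p]) (isClosed_eq (hχ.1.comp continuous_subtype_val) continuous_const) fun b => ?_
  have h := hχ.2 b 0
  rw [pow_zero, pow_zero, div_one, div_one] at h
  rw [PadicInt.coe_intCast, h, Complex.exp_eq_one_iff]
  exact ⟨b, by ring⟩

lemma inv_prime_ne_one (hχ : IsStdChar p χ) : χ ((p : ℚ_[p])⁻¹) ≠ 1 := by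
  have h := hχ.2 1 1
  rw [Int.cast_one, pow_one, one_div] at h
  rw [h, Ne, Complex.exp_eq_one_iff]
  rintro ⟨n, hn⟩
  have hp0 : (p : ℂ) ≠ 0 := mod_cast (Fact.out : p.Prime).ne_zero
  have h2 : (n : ℂ) * p = 1 := by
    have h3 := Complex.two_pi_I_ne_zero
    field_simp at hn
    have h4 : 2 * (Real.pi : ℂ) * Complex.I * (n * p) = 2 * (Real.pi : ℂ) * Complex.I * 1 := by
      push_cast at hn
      linear_combination (2 * (Real.pi : ℂ) * Complex.I) * (-hn)
    exact mul_left_cancel₀ h3 h4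
  have h3 : n * (p : ℤ) = 1 := mod_cast h2
  have h4 : ((p : ℕ) : ℤ) ∣ 1 := Dvd.intro_left n h3
  exact (Fact.out : p.Prime).one_lt.ne' (by exact_mod_cast Int.eq_one_of_dvd_one (by positivity) h4)

end IsStdChar

/-- If `f(x)` is small, then `x` pairs trivially with the ball `{|f°| ≤ p ^ k}`. -/
lemma norm_pairing_le_one {a : ℤ} (ha : IsQNR p a) {k : ℤ} {x ξ : V p}
    (hx : ‖qf p a x‖ ≤ (p : ℝ) ^ (-k)) (hξ : ‖qfc p a ξ‖ ≤ (p : ℝ) ^ k) :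
    ‖∑ i, ξ i * x i‖ ≤ 1 := by
  refine IsUltrametricDist.norm_sum_le_of_forall_le_of_nonneg zero_le_one fun i _ => ?_
  by_cases h0 : ξ i * x i = 0
  · simp [h0]
  have h := mul_le_mul ((norm_qfc_le_iff ha).1 hξ i) ((norm_qf_le_iff ha).1 hx i)
    (mul_nonneg (wt_pos i).le (sq_nonneg _)) (zpow_nonneg pos_prime.le _)
  rw [← zpow_add₀ pos_prime.ne', add_neg_cancel, zpow_zero] at h
  have h2 : (p : ℝ)⁻¹ * ‖ξ i * x i‖ ^ 2 ≤ 1 := by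
    rw [← wt_mul_wt_rev i, norm_mul]
    linarith
  obtain ⟨n, hn⟩ := exists_norm_eq_zpow h0
  rw [hn] at h2 ⊢
  rw [← zpow_natCast, ← zpow_mul, ← zpow_neg_one, ← zpow_add₀ pos_prime.ne',
    zpow_le_one_iff_right₀ one_lt_prime] at h2
  rw [zpow_le_one_iff_right₀ one_lt_prime]
  push_cast at h2
  omega

lemma norm_le_zpow_of_lt {y : ℚ_[p]} {k : ℤ} (h : (p : ℝ) ^ k < ‖y‖) : (p : ℝ) ^ (k + 1) ≤ ‖y‖ := by
  have hy : y ≠ 0 := by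
    rintro rfl
    rw [norm_zero] at h
    exact h.not_ge (zpow_nonneg pos_prime.le _)
  obtain ⟨n, hn⟩ := exists_norm_eq_zpow hy
  rw [hn] at h ⊢
  rw [zpow_lt_zpow_iff_right₀ one_lt_prime] at h
  exact zpow_le_zpow_right₀ one_lt_prime.le h

/-- If `f(x)` is not small, then `x` pairs nontrivially with the ball `{|f°| ≤ p ^ k}`. -/
lemma exists_char_ne_one {a : ℤ} (ha : IsQNR p a) {χ : ℚ_[p] → ℂ} (hχ : IsStdChar p χ) {k : ℤ}
    {x : V p} (hx : (p : ℝ) ^ (-k) < ‖qf p a x‖) :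
    ∃ ξ : V p, ‖qfc p a ξ‖ ≤ (p : ℝ) ^ k ∧ χ (∑ i, ξ i * x i) ≠ 1 := by
  have hp0 : (p : ℚ_[p]) ≠ 0 := mod_cast (Fact.out : p.Prime).ne_zero
  obtain ⟨i, hi⟩ : ∃ i, (p : ℝ) ^ (-k + 1) ≤ wt p i * ‖x i‖ ^ 2 := by
    by_contra! h
    obtain ⟨j, -, hj⟩ := Finset.exists_max_image Finset.univ (fun i => wt p i * ‖x i‖ ^ 2)
      Finset.univ_nonempty
    have h1 := (norm_qf_le_iff ha (r := wt p j * ‖x j‖ ^ 2)).2 fun i => hj i (Finset.mem_univ _)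
    exact ((norm_le_zpow_of_lt hx).trans h1).not_gt (h j)
  have hxi : x i ≠ 0 := by
    intro h
    rw [h, norm_zero, zero_pow two_ne_zero, mul_zero] at hi
    exact hi.not_gt (zpow_pos pos_prime _)
  refine ⟨Pi.single i ((p : ℚ_[p])⁻¹ * (x i)⁻¹), (norm_qfc_le_iff ha).2 fun j => ?_, ?_⟩
  · rcases eq_or_ne j i with rfl | hj
    · rw [Pi.single_eq_same, norm_mul, norm_inv, norm_inv, Padic.norm_p, inv_inv]
      have hn : 0 < ‖x j‖ := norm_pos_iff.2 hxi
      have hw := wt_mul_wt_rev (p := p) j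
      have hp := pos_prime (p := p)
      have hwj := wt_pos (p := p) j
      have e : wt p j.rev * (p * ‖x j‖⁻¹) ^ 2 = p / (wt p j * ‖x j‖ ^ 2) := by
        have : wt p j.rev = (p : ℝ)⁻¹ / wt p j := by rw [← hw]; field_simp
        rw [this]
        field_simp
      rw [e, div_le_iff₀ (by positivity)]
      calc (p : ℝ) = (p : ℝ) ^ k * (p : ℝ) ^ (-k + 1) := by
            rw [← zpow_add₀ hp.ne']; simp
        _ ≤ _ := by gcongr
    · rw [Pi.single_eq_of_ne hj, norm_zero, zero_pow two_ne_zero, mul_zero]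
      exact zpow_nonneg pos_prime.le _
  · have : ∑ j, (Pi.single i ((p : ℚ_[p])⁻¹ * (x i)⁻¹) : V p) j * x j = (p : ℚ_[p])⁻¹ := by
      rw [Finset.sum_eq_single i (fun j _ hj => by rw [Pi.single_eq_of_ne hj, zero_mul]) (by simp),
        Pi.single_eq_same, inv_mul_cancel_right₀ hxi]
    rw [this]
    exact hχ.inv_prime_ne_one

section Volume

variable {μ : Measure (V p)} [μ.IsAddHaarMeasure]

lemma exists_fin_norm_sub_le {y : ℚ_[p]} {j : ℤ} (hy : ‖y‖ ≤ (p : ℝ) ^ (j + 1)) :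
    ∃ n : Fin p, ‖y - ((n : ℕ) : ℚ_[p]) * (p : ℚ_[p]) ^ (-(j + 1))‖ ≤ (p : ℝ) ^ j := by
  have hp0 : (p : ℚ_[p]) ≠ 0 := mod_cast (Fact.out : p.Prime).ne_zero
  have hz : ‖y * (p : ℚ_[p]) ^ (j + 1)‖ ≤ 1 := by
    rw [norm_mul, Padic.norm_p_zpow, zpow_neg, ← div_eq_mul_inv,
      div_le_one (zpow_pos pos_prime _)]
    exact hy
  obtain ⟨z, hz'⟩ : ∃ z : ℤ_[p], (z : ℚ_[p]) = y * (p : ℚ_[p]) ^ (j + 1) := ⟨⟨_, hz⟩, rfl⟩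
  refine ⟨⟨z.zmodRepr, z.zmodRepr_lt_p⟩, ?_⟩
  have h := PadicInt.norm_sub_zmodRepr_lt_one z
  rw [PadicInt.norm_def, PadicInt.coe_sub, PadicInt.coe_natCast, hz'] at h
  have e : y - ((z.zmodRepr : ℕ) : ℚ_[p]) * (p : ℚ_[p]) ^ (-(j + 1)) =
      (y * (p : ℚ_[p]) ^ (j + 1) - z.zmodRepr) * (p : ℚ_[p]) ^ (-(j + 1)) := by
    rw [sub_mul, mul_assoc, ← zpow_add₀ hp0, add_neg_cancel, zpow_zero, mul_one]
  rw [← not_lt]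
  intro h'
  replace h' := norm_le_zpow_of_lt h'
  rw [e, norm_mul, Padic.norm_p_zpow, neg_neg] at h'
  exact h'.not_gt (mul_lt_of_lt_one_left (zpow_pos pos_prime _) h)

lemma norm_sub_natCast_eq_one {m n : Fin p} (h : m ≠ n) :
    ‖((m : ℕ) : ℚ_[p]) - ((n : ℕ) : ℚ_[p])‖ = 1 := by
  have e : ((m : ℕ) : ℚ_[p]) - ((n : ℕ) : ℚ_[p]) = (((m : ℤ) - (n : ℤ) : ℤ) : ℚ_[p]) := by
    push_cast
    rfl
  rw [e]
  refine le_antisymm (Padic.norm_int_le_one _) (not_lt.1 fun h' => h ?_)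
  rw [Padic.norm_intCast_lt_one_iff] at h'
  have h2 := Int.eq_zero_of_abs_lt_dvd h' (by
    rw [abs_lt]
    omega)
  exact Fin.ext (by omega)

lemma measure_ball_succ (j : ℤ) :
    μ {x : V p | ‖x‖ ≤ (p : ℝ) ^ (j + 1)} = p ^ 4 * μ {x : V p | ‖x‖ ≤ (p : ℝ) ^ j} := by
  set B : Set (V p) := {x : V p | ‖x‖ ≤ (p : ℝ) ^ j} with hB
  let s : (Fin 4 → Fin p) → V p := fun n i => ((n i : ℕ) : ℚ_[p]) * (p : ℚ_[p]) ^ (-(j + 1))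
  have hpj := zpow_nonneg (pos_prime (p := p)).le j
  have hpj1 := zpow_nonneg (pos_prime (p := p)).le (j + 1)
  have hunion : {x : V p | ‖x‖ ≤ (p : ℝ) ^ (j + 1)} = ⋃ n, (fun x => x - s n) ⁻¹' B := by
    ext x
    simp only [mem_ofPred_eq, mem_iUnion, mem_preimage, hB]
    constructor
    · intro hx
      choose n hn using fun i => exists_fin_norm_sub_le ((norm_le_pi_norm x i).trans hx)
      exact ⟨n, (pi_norm_le_iff_of_nonneg hpj).2 hn⟩
    · rintro ⟨n, hn⟩
      refine (pi_norm_le_iff_of_nonneg hpj1).2 fun i => ?_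
      have h1 := (norm_le_pi_norm _ i).trans hn
      have h2 : ‖s n i‖ ≤ (p : ℝ) ^ (j + 1) := by
        rw [norm_mul, Padic.norm_p_zpow, neg_neg]
        exact mul_le_of_le_one_left hpj1 (by exact_mod_cast Padic.norm_int_le_one ((n i : ℕ) : ℤ))
      have h3 := Padic.nonarchimedean (x i - s n i) (s n i)
      rw [sub_add_cancel] at h3
      exact h3.trans (max_le (h1.trans (zpow_le_zpow_right₀ one_lt_prime.le (by omega))) h2)
  have hmeas : MeasurableSet B := (isClosed_le continuous_norm continuous_const).measurableSet
  rw [hunion, measure_iUnion]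
  · simp_rw [sub_eq_add_neg, measure_preimage_add_right]
    rw [tsum_fintype, Finset.sum_const, Finset.card_univ, Fintype.card_fun, Fintype.card_fin,
      Fintype.card_fin, nsmul_eq_mul]
    push_cast
    rfl
  · intro m n hmn
    refine Set.disjoint_left.2 fun x hm hn => ?_
    obtain ⟨i, hi⟩ := Function.ne_iff.1 hmn
    have h1 : ‖x i - s m i‖ ≤ (p : ℝ) ^ j := (norm_le_pi_norm (x - s m) i).trans hm
    have h2 : ‖x i - s n i‖ ≤ (p : ℝ) ^ j := (norm_le_pi_norm (x - s n) i).trans hn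
    have h3 := Padic.nonarchimedean (x i - s n i) (-(x i - s m i))
    rw [norm_neg] at h3
    have e : x i - s n i + -(x i - s m i) =
        (((m i : ℕ) : ℚ_[p]) - ((n i : ℕ) : ℚ_[p])) * (p : ℚ_[p]) ^ (-(j + 1)) := by
      simp only [s]
      ring
    rw [e, norm_mul, norm_sub_natCast_eq_one hi, Padic.norm_p_zpow, neg_neg, one_mul] at h3
    exact (h3.trans (max_le h2 h1)).not_gt (zpow_lt_zpow_right₀ one_lt_prime (by omega))
  · intro n
    exact (measurable_id.sub_const _) hmeas

lemma measure_ball (hμ : μ {x : V p | ‖x‖ ≤ 1} = 1) (j : ℤ) :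
    μ {x : V p | ‖x‖ ≤ (p : ℝ) ^ j} = ENNReal.ofReal (((p : ℝ) ^ j) ^ 4) := by
  have hp4 : (p : ENNReal) ^ 4 = ENNReal.ofReal ((p : ℝ) ^ 4) := by
    rw [ENNReal.ofReal_pow pos_prime.le, ENNReal.ofReal_natCast]
  have key : ∀ j : ℤ, ENNReal.ofReal (((p : ℝ) ^ (j + 1)) ^ 4) =
      p ^ 4 * ENNReal.ofReal (((p : ℝ) ^ j) ^ 4) := fun j => by
    rw [hp4, ← ENNReal.ofReal_mul (by positivity), zpow_add_one₀ pos_prime.ne', mul_pow, mul_comm]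
  have hp0 : (p : ENNReal) ^ 4 ≠ 0 := pow_ne_zero _ (mod_cast (Fact.out : p.Prime).ne_zero)
  have hpt : (p : ENNReal) ^ 4 ≠ ⊤ := ENNReal.pow_ne_top (ENNReal.natCast_ne_top p)
  induction j using Int.induction_on with
  | zero => simpa using hμ
  | succ n ih => rw [measure_ball_succ, ih, key]
  | pred n ih =>
    have h1 := measure_ball_succ (μ := μ) (-(n : ℤ) - 1)
    have h2 := key (-(n : ℤ) - 1)
    rw [sub_add_cancel] at h1 h2
    rw [ih, h2] at h1
    exact ((ENNReal.mul_right_inj hp0 hpt).1 h1).symm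

lemma measure_norm_sq_le (hμ : μ {x : V p | ‖x‖ ≤ 1} = 1) {r : ℝ} (hr : 0 < r) :
    μ {x : V p | ‖x‖ ^ 2 ≤ r} ≤ ENNReal.ofReal (r ^ 2) := by
  obtain ⟨n, hn⟩ := exists_mem_Ico_zpow (Real.sqrt_pos.2 hr) (one_lt_prime (p := p))
  have hsub : {x : V p | ‖x‖ ^ 2 ≤ r} ⊆ {x : V p | ‖x‖ ≤ (p : ℝ) ^ n} := by
    intro x hx
    refine (pi_norm_le_iff_of_nonneg (zpow_nonneg pos_prime.le n)).2 fun i => not_lt.1 fun h => ?_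
    have h1 : ‖x‖ ≤ √r := (Real.le_sqrt (norm_nonneg _) hr.le).2 hx
    exact ((norm_le_zpow_of_lt h).trans ((norm_le_pi_norm x i).trans h1)).not_gt hn.2
  refine (measure_mono hsub).trans ?_
  rw [measure_ball hμ]
  refine ENNReal.ofReal_le_ofReal ?_
  calc ((p : ℝ) ^ n) ^ 4 ≤ (√r) ^ 4 := pow_le_pow_left₀ (zpow_nonneg pos_prime.le n) hn.1 4
    _ = r ^ 2 := by rw [show (4 : ℕ) = 2 * 2 from rfl, pow_mul, Real.sq_sqrt hr.le]

lemma measure_norm_qf_le (hμ : μ {x : V p | ‖x‖ ≤ 1} = 1) {a : ℤ} (ha : IsQNR p a) {r : ℝ}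
    (hr : 0 < r) : μ {x : V p | ‖qf p a x‖ ≤ r} ≤ ENNReal.ofReal ((p * r) ^ 2) :=
  (measure_mono fun x hx => (norm_sq_le_mul_norm_qf ha x).trans
    (mul_le_mul_of_nonneg_left hx pos_prime.le)).trans
    (measure_norm_sq_le hμ (mul_pos pos_prime hr))

lemma measure_norm_qfc_le (hμ : μ {x : V p | ‖x‖ ≤ 1} = 1) {a : ℤ} (ha : IsQNR p a) {r : ℝ}
    (hr : 0 < r) : μ {x : V p | ‖qfc p a x‖ ≤ r} ≤ ENNReal.ofReal ((p * r) ^ 2) :=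
  (measure_mono fun x hx => (norm_sq_le_mul_norm_qfc ha x).trans
    (mul_le_mul_of_nonneg_left hx pos_prime.le)).trans
    (measure_norm_sq_le hμ (mul_pos pos_prime hr))

end Volume

section Coefficients

variable (p) in
/-- The value `exp (-τ p ^ (k α))` of the heat multiplier on the sphere `|f°| = p ^ k`. -/
def expLevel (τ α : ℝ) (k : ℤ) : ℝ := Real.exp (-(τ * ((p : ℝ) ^ k) ^ α))

variable (p) in
/-- The drop of the heat multiplier between the spheres of radius `p ^ k` and `p ^ (k + 1)`. -/
def coef (τ α : ℝ) (k : ℤ) : ℝ := expLevel p τ α k - expLevel p τ α (k + 1)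

variable {τ α : ℝ}

lemma coef_nonneg (hτ : 0 < τ) (hα : 0 < α) (k : ℤ) : 0 ≤ coef p τ α k := by
  refine sub_nonneg.2 (Real.exp_le_exp.2 (neg_le_neg (mul_le_mul_of_nonneg_left ?_ hτ.le)))
  exact Real.rpow_le_rpow (zpow_nonneg pos_prime.le k)
    (zpow_le_zpow_right₀ one_lt_prime.le (by omega)) hα.le

omit [Fact p.Prime] in
lemma coef_le_expLevel (k : ℤ) : coef p τ α k ≤ expLevel p τ α k :=
  sub_le_self _ (Real.exp_pos _).le

lemma tendsto_expLevel_atTop (hτ : 0 < τ) (hα : 0 < α) (j : ℤ) :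
    Tendsto (fun n : ℕ => expLevel p τ α (j + n)) atTop (nhds 0) := by
  refine Real.tendsto_exp_neg_atTop_nhds_zero.comp ((Tendsto.const_mul_atTop hτ) ?_)
  refine (tendsto_rpow_atTop hα).comp ?_
  simp_rw [zpow_add₀ (pos_prime (p := p)).ne', zpow_natCast]
  exact (tendsto_pow_atTop_atTop_of_one_lt one_lt_prime).const_mul_atTop (zpow_pos pos_prime j)

lemma tendsto_expLevel_atBot (hα : 0 < α) :
    Tendsto (fun n : ℕ => expLevel p τ α (-(n : ℤ))) atTop (nhds 1) := by
  have h1 : Tendsto (fun n : ℕ => (p : ℝ) ^ (-(n : ℤ))) atTop (nhds 0) := by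
    simp_rw [zpow_neg, zpow_natCast]
    exact (tendsto_pow_atTop_atTop_of_one_lt one_lt_prime).inv_tendsto_atTop
  have h2 := (h1.rpow_const (p := α) (Or.inr hα.le)).const_mul τ
  rw [Real.zero_rpow hα.ne', mul_zero] at h2
  have h3 := (Real.continuous_exp.tendsto _).comp h2.neg
  rwa [neg_zero, Real.exp_zero] at h3

lemma hasSum_coef_nat (hτ : 0 < τ) (hα : 0 < α) (j : ℤ) :
    HasSum (fun n : ℕ => coef p τ α (j + n)) (expLevel p τ α j) := by
  rw [hasSum_iff_tendsto_nat_of_nonneg fun n => coef_nonneg hτ hα _]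
  have h : ∀ n : ℕ, ∑ i ∈ Finset.range n, coef p τ α (j + i) =
      expLevel p τ α j - expLevel p τ α (j + n) := fun n => by
    have := Finset.sum_range_sub' (fun i : ℕ => expLevel p τ α (j + i)) n
    simp only [Nat.cast_zero, add_zero, Nat.cast_succ, ← add_assoc] at this
    exact this
  simp_rw [h]
  simpa using (tendsto_expLevel_atTop hτ hα j).const_sub (expLevel p τ α j)

lemma hasSum_coef (hτ : 0 < τ) (hα : 0 < α) : HasSum (coef p τ α) 1 := by
  have h1 : HasSum (fun n : ℕ => coef p τ α n) (expLevel p τ α 0) := by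
    simpa using hasSum_coef_nat hτ hα 0
  have h2 : HasSum (fun n : ℕ => coef p τ α (-(n + 1 : ℤ))) (1 - expLevel p τ α 0) := by
    rw [hasSum_iff_tendsto_nat_of_nonneg fun n => coef_nonneg hτ hα _]
    have h : ∀ n : ℕ, ∑ i ∈ Finset.range n, coef p τ α (-(i + 1 : ℤ)) =
        expLevel p τ α (-(n : ℤ)) - expLevel p τ α 0 := fun n => by
      have := Finset.sum_range_sub (fun i : ℕ => expLevel p τ α (-(i : ℤ))) n
      simp only [Nat.cast_zero, neg_zero, Nat.cast_succ] at this
      rw [← this]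
      refine Finset.sum_congr rfl fun i _ => ?_
      rw [coef]
      congr 2
      ring
    simp_rw [h]
    exact (tendsto_expLevel_atBot hα).sub_const _
  simpa using h1.of_nat_of_neg_add_one h2

lemma hasSum_coef_indicator (hτ : 0 < τ) (hα : 0 < α) (y : ℚ_[p]) :
    HasSum (fun k : ℤ => if ‖y‖ ≤ (p : ℝ) ^ k then coef p τ α k else 0)
      (Real.exp (-(τ * ‖y‖ ^ α))) := by
  by_cases hy : y = 0
  · simp only [hy, norm_zero, zpow_nonneg (pos_prime (p := p)).le, if_true,
      Real.zero_rpow hα.ne', mul_zero, neg_zero, Real.exp_zero]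
    exact hasSum_coef hτ hα
  obtain ⟨j, hj⟩ := exists_norm_eq_zpow hy
  simp only [hj, zpow_le_zpow_iff_right₀ (one_lt_prime (p := p))]
  have hinj : Function.Injective fun n : ℕ => j + (n : ℤ) := fun m n h => by
    simpa using h
  rw [← hinj.hasSum_iff]
  · simpa [Function.comp_def, expLevel] using hasSum_coef_nat (p := p) hτ hα j
  · intro k hk
    refine if_neg fun hjk => hk ⟨(k - j).toNat, ?_⟩
    change j + ((k - j).toNat : ℤ) = k
    omega

lemma summable_rpow_mul_expLevel (hα : 0 < α) {θ : ℝ} (hθ : 0 < θ) :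
    Summable fun k : ℤ => ((p : ℝ) ^ k) ^ θ * expLevel p 1 α k := by
  have hp := pos_prime (p := p)
  have hp1 := one_lt_prime (p := p)
  refine Summable.of_nat_of_neg ?_ ?_
  · obtain ⟨n, hn⟩ := exists_nat_ge ((θ + 1) / α)
    rw [div_le_iff₀ hα] at hn
    refine Summable.of_nonneg_of_le (fun k => by rw [expLevel]; positivity) (fun k => ?_)
      ((summable_geometric_of_lt_one (inv_nonneg.2 hp.le) (inv_lt_one_of_one_lt₀ hp1)).mul_left
        (n.factorial : ℝ))
    have hx : 1 ≤ (p : ℝ) ^ k := one_le_pow₀ hp1.le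
    have hx0 : 0 < (p : ℝ) ^ k := by positivity
    rw [expLevel, zpow_natCast, one_mul, inv_pow]
    set x := (p : ℝ) ^ k
    have h1 := Real.pow_div_factorial_le_exp (x ^ α) (by positivity) n
    have h2 : x ^ θ * x ≤ (x ^ α) ^ n := by
      rw [← Real.rpow_natCast, ← Real.rpow_mul hx0.le, ← Real.rpow_add_one hx0.ne']
      exact Real.rpow_le_rpow_of_exponent_le hx (by linarith)
    rw [div_le_iff₀ (by positivity)] at h1
    rw [Real.exp_neg, ← div_eq_mul_inv, ← div_eq_mul_inv, div_le_div_iff₀ (Real.exp_pos _) hx0]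
    linarith
  · have hq : (p : ℝ) ^ (-θ) < 1 := Real.rpow_lt_one_of_one_lt_of_neg hp1 (neg_lt_zero.2 hθ)
    refine Summable.of_nonneg_of_le (fun k => by rw [expLevel]; positivity) (fun k => ?_)
      (summable_geometric_of_lt_one (by positivity) hq)
    have h1 : ((p : ℝ) ^ (-(k : ℤ))) ^ θ = ((p : ℝ) ^ (-θ)) ^ k := by
      rw [← Real.rpow_intCast, ← Real.rpow_mul hp.le, ← Real.rpow_natCast, ← Real.rpow_mul hp.le]
      push_cast
      ring_nf
    rw [← h1]
    refine mul_le_of_le_one_right (by positivity) (Real.exp_le_one_iff.2 ?_)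
    rw [neg_nonpos]
    positivity

variable (p) in
lemma exists_tsum_rpow_mul_coef_le (hα : 0 < α) {θ : ℝ} (hθ : 0 < θ) :
    ∃ C : ℝ, 0 < C ∧ ∀ τ : ℝ, 0 < τ →
      (Summable fun k : ℤ => ((p : ℝ) ^ k) ^ θ * coef p τ α k) ∧
      ∑' k : ℤ, ((p : ℝ) ^ k) ^ θ * coef p τ α k ≤ C * τ ^ (-(θ / α)) := by
  have hp := pos_prime (p := p)
  have hS := summable_rpow_mul_expLevel (p := p) hα hθ
  set g : ℤ → ℝ := fun k => ((p : ℝ) ^ k) ^ θ * expLevel p 1 α k with hg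
  have hg0 : ∀ k, 0 < g k := fun k => mul_pos (by positivity) (Real.exp_pos _)
  refine ⟨(p : ℝ) ^ θ * ∑' k, g k, mul_pos (by positivity)
    (hS.tsum_pos (fun k => (hg0 k).le) 0 (hg0 0)), fun τ hτ => ?_⟩
  set T : ℝ := τ ^ (-(1 / α)) with hT
  have hT0 : 0 < T := by positivity
  have hTα : T ^ α = τ⁻¹ := by
    rw [hT, ← Real.rpow_mul hτ.le, ← Real.rpow_neg_one]
    congr 1
    field_simp
  have hTθ : T ^ θ = τ ^ (-(θ / α)) := by
    rw [hT, ← Real.rpow_mul hτ.le]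
    congr 1
    ring
  obtain ⟨m, hm1, hm2⟩ := exists_mem_Ico_zpow hT0 (one_lt_prime (p := p))
  have hbound : ∀ k : ℤ, ((p : ℝ) ^ k) ^ θ * coef p τ α k ≤
      (p : ℝ) ^ θ * T ^ θ * g (k - (m + 1)) := fun k => by
    obtain ⟨j, rfl⟩ : ∃ j, k = j + (m + 1) := ⟨k - (m + 1), by ring⟩
    rw [add_sub_cancel_right, hg]
    have h1 : ((p : ℝ) ^ (j + (m + 1))) ^ θ ≤ (p : ℝ) ^ θ * T ^ θ * ((p : ℝ) ^ j) ^ θ := by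
      rw [← Real.mul_rpow hp.le hT0.le, ← Real.mul_rpow (by positivity) (by positivity)]
      refine Real.rpow_le_rpow (by positivity) ?_ hθ.le
      rw [zpow_add₀ hp.ne', zpow_add_one₀ hp.ne', mul_comm, mul_comm ((p : ℝ) ^ m)]
      gcongr
    have h2 : coef p τ α (j + (m + 1)) ≤ expLevel p 1 α j := by
      refine (coef_le_expLevel _).trans (Real.exp_le_exp.2 (neg_le_neg ?_))
      have : ((p : ℝ) ^ j * T) ^ α ≤ ((p : ℝ) ^ (j + (m + 1))) ^ α := by
        refine Real.rpow_le_rpow (by positivity) ?_ hα.le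
        rw [zpow_add₀ hp.ne']
        gcongr
      rw [Real.mul_rpow (by positivity) hT0.le, hTα, ← div_eq_mul_inv, div_le_iff₀ hτ] at this
      linarith
    calc _ ≤ _ := mul_le_mul h1 h2 (coef_nonneg hτ hα _) (by positivity)
      _ = _ := by ring
  have hS' : Summable fun k : ℤ => (p : ℝ) ^ θ * T ^ θ * g (k - (m + 1)) :=
    ((Equiv.subRight (m + 1)).summable_iff.2 hS).mul_left _
  have hS'' := Summable.of_nonneg_of_le
    (fun k => mul_nonneg (by positivity) (coef_nonneg hτ hα k)) hbound hS'
  refine ⟨hS'', (hS''.tsum_le_tsum hbound hS').trans ?_⟩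
  have hshift : ∑' k, g (k - (m + 1)) = ∑' k, g k := (Equiv.subRight (m + 1)).tsum_eq g
  rw [tsum_mul_left, hshift, ← hTθ]
  exact le_of_eq (by ring)

end Coefficients

section Fourier

variable {μ : Measure (V p)} [μ.IsAddHaarMeasure]

variable (p) in
/-- The ball `{|f°| ≤ p ^ k}`. -/
def dualBall (a : ℤ) (k : ℤ) : Set (V p) := {ξ | ‖qfc p a ξ‖ ≤ (p : ℝ) ^ k}

variable (p) in
/-- The indicator function of the ball `{|f| ≤ p ^ (-k)}`. -/
def ballInd (a : ℤ) (k : ℤ) (x : V p) : ℝ := if ‖qf p a x‖ ≤ (p : ℝ) ^ (-k) then 1 else 0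

lemma measurableSet_dualBall (a k : ℤ) : MeasurableSet (dualBall p a k) :=
  (isClosed_le (continuous_qfc a).norm continuous_const).measurableSet

lemma measure_dualBall_le (hμ : μ {x : V p | ‖x‖ ≤ 1} = 1) {a : ℤ} (ha : IsQNR p a) (k : ℤ) :
    μ (dualBall p a k) ≤ ENNReal.ofReal ((p * (p : ℝ) ^ k) ^ 2) :=
  measure_norm_qfc_le hμ ha (zpow_pos pos_prime k)

lemma measureReal_dualBall_le (hμ : μ {x : V p | ‖x‖ ≤ 1} = 1) {a : ℤ} (ha : IsQNR p a) (k : ℤ) :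
    μ.real (dualBall p a k) ≤ (p * (p : ℝ) ^ k) ^ 2 :=
  ENNReal.toReal_le_of_le_ofReal (by positivity) (measure_dualBall_le hμ ha k)

lemma measure_dualBall_ne_top (hμ : μ {x : V p | ‖x‖ ≤ 1} = 1) {a : ℤ} (ha : IsQNR p a) (k : ℤ) :
    μ (dualBall p a k) ≠ ⊤ :=
  ((measure_dualBall_le hμ ha k).trans_lt ENNReal.ofReal_lt_top).ne

lemma continuous_char_pairing {χ : ℚ_[p] → ℂ} (hχ : IsStdChar p χ) (x : V p) :
    Continuous fun ξ : V p => χ (∑ i, ξ i * x i) :=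
  hχ.1.comp (by fun_prop)

lemma integral_char_dualBall {a : ℤ} (ha : IsQNR p a) {χ : ℚ_[p] → ℂ} (hχ : IsStdChar p χ)
    (k : ℤ) (x : V p) :
    ∫ ξ in dualBall p a k, χ (∑ i, ξ i * x i) ∂μ =
      ((μ.real (dualBall p a k) * ballInd p a k x : ℝ) : ℂ) := by
  by_cases hx : ‖qf p a x‖ ≤ (p : ℝ) ^ (-k)
  · rw [setIntegral_congr_fun (g := fun _ => (1 : ℂ)) (measurableSet_dualBall a k)
      fun ξ hξ => hχ.eq_one_of_norm_le_one (norm_pairing_le_one ha hx hξ), setIntegral_const,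
      ballInd, if_pos hx]
    simp
  · obtain ⟨η, hη, hη1⟩ := exists_char_ne_one ha hχ (not_le.1 hx)
    rw [ballInd, if_neg hx, mul_zero, Complex.ofReal_zero,
      ← integral_indicator (measurableSet_dualBall a k)]
    set g := (dualBall p a k).indicator fun ξ => χ (∑ i, ξ i * x i) with hg
    have h : ∀ ξ, g (ξ + η) = χ (∑ i, η i * x i) * g ξ := fun ξ => by
      have hmem : ξ + η ∈ dualBall p a k ↔ ξ ∈ dualBall p a k := by
        refine ⟨fun h => ?_, fun h => norm_qfc_add_le ha h hη⟩
        have := norm_qfc_add_le ha h (y := -η) (by rwa [qfc_neg])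
        rwa [add_neg_cancel_right] at this
      by_cases hξ : ξ ∈ dualBall p a k
      · rw [hg, indicator_of_mem (hmem.2 hξ), indicator_of_mem hξ, ← hχ.map_add,
          ← Finset.sum_add_distrib]
        congr 1
        exact Finset.sum_congr rfl fun i _ => by rw [Pi.add_apply]; ring
      · rw [hg, indicator_of_notMem (mt hmem.1 hξ), indicator_of_notMem hξ, mul_zero]
    have h1 := integral_add_right_eq_self (μ := μ) g η
    simp_rw [h, integral_const_mul] at h1
    by_contra h0
    exact hη1 ((mul_eq_right₀ h0).1 h1)

lemma hasSum_heatZ (hμ : μ {x : V p | ‖x‖ ≤ 1} = 1) {a : ℤ} (ha : IsQNR p a) {χ : ℚ_[p] → ℂ}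
    (hχ : IsStdChar p χ) {κ α t : ℝ} (hτ : 0 < κ * t) (hα : 0 < α) (x : V p) :
    HasSum (fun k : ℤ =>
        ((coef p (κ * t) α k * (μ.real (dualBall p a k) * ballInd p a k x) : ℝ) : ℂ))
      (heatZ p μ χ a κ α x t) := by
  set F : ℤ → V p → ℂ := fun k => (dualBall p a k).indicator fun ξ =>
    (coef p (κ * t) α k : ℂ) * χ (∑ i, ξ i * x i) with hF
  have hnorm : ∀ k ξ, ‖F k ξ‖ = (dualBall p a k).indicator (fun _ => coef p (κ * t) α k) ξ :=
    fun k ξ => by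
      rw [hF, norm_indicator_eq_indicator_norm]
      congr 1
      ext η
      rw [norm_mul, hχ.norm_eq_one, mul_one, Complex.norm_of_nonneg (coef_nonneg hτ hα k)]
  have hint : ∀ k, Integrable (F k) μ := fun k => by
    refine Integrable.mono' (g := (dualBall p a k).indicator fun _ => coef p (κ * t) α k)
      ((integrable_indicator_iff (measurableSet_dualBall a k)).2
        (integrableOn_const (measure_dualBall_ne_top hμ ha k)))
      ((continuous_const.mul (continuous_char_pairing hχ x)).aestronglyMeasurable.indicator
        (measurableSet_dualBall a k)) (ae_of_all _ fun ξ => (hnorm k ξ).le)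
  have hsum : Summable fun k => ∫ ξ, ‖F k ξ‖ ∂μ := by
    obtain ⟨C, -, hC⟩ := exists_tsum_rpow_mul_coef_le p hα two_pos
    refine Summable.of_nonneg_of_le (fun k => integral_nonneg fun ξ => norm_nonneg _) (fun k => ?_)
      ((hC _ hτ).1.mul_left ((p : ℝ) ^ 2))
    simp_rw [hnorm]
    rw [integral_indicator (measurableSet_dualBall a k), setIntegral_const, smul_eq_mul,
      Real.rpow_two, ← mul_assoc, ← mul_pow]
    exact mul_le_mul_of_nonneg_right (measureReal_dualBall_le hμ ha k) (coef_nonneg hτ hα k)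
  have h := hasSum_integral_of_summable_integral_norm hint hsum
  have h1 : ∀ k, ∫ ξ, F k ξ ∂μ =
      ((coef p (κ * t) α k * (μ.real (dualBall p a k) * ballInd p a k x) : ℝ) : ℂ) := fun k => by
    rw [integral_indicator (measurableSet_dualBall a k), integral_const_mul,
      integral_char_dualBall ha hχ, Complex.ofReal_mul (coef p (κ * t) α k)]
  simp_rw [h1] at h
  have e : heatZ p μ χ a κ α x t = ∫ ξ, ∑' k, F k ξ ∂μ := by
    refine integral_congr_ae (ae_of_all _ fun ξ => ?_)
    have h2 := (Complex.hasSum_ofReal.2 (hasSum_coef_indicator hτ hα (qfc p a ξ))).mul_left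
      (χ (∑ i, ξ i * x i))
    refine Eq.trans h2.tsum_eq.symm (tsum_congr fun k => ?_)
    simp only [hF]
    by_cases hξ : ξ ∈ dualBall p a k
    · rw [indicator_of_mem hξ, if_pos (show ‖qfc p a ξ‖ ≤ _ from hξ), mul_comm]
    · rw [indicator_of_notMem hξ, if_neg (show ¬ ‖qfc p a ξ‖ ≤ _ from hξ), Complex.ofReal_zero,
        mul_zero]
  rw [e]
  exact h

end Fourier

section Operator

variable {μ : Measure (V p)} [μ.IsAddHaarMeasure]

lemma measurable_norm_qf_rpow (a : ℤ) (s : ℝ) : Measurable fun y : V p => ‖qf p a y‖ ^ s :=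
  (continuous_qf a).norm.measurable.pow_const s

/-- The tail of the singular kernel `|f(y)|_p ^ (-γ - 2)`. -/
lemma lintegral_tail_le (hμ : μ {x : V p | ‖x‖ ≤ 1} = 1) {a : ℤ} (ha : IsQNR p a) {γ : ℝ}
    (hγ : 0 < γ) (k : ℤ) :
    ∫⁻ y in {y : V p | (p : ℝ) ^ (-k) < ‖qf p a y‖}, ENNReal.ofReal (‖qf p a y‖ ^ (-γ - 2)) ∂μ ≤
      ENNReal.ofReal ((p : ℝ) ^ 2 * (1 - (p : ℝ) ^ (-γ))⁻¹ * ((p : ℝ) ^ k) ^ γ) := by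
  have hp := pos_prime (p := p)
  set u : ℕ → ℝ := fun i => (p : ℝ) ^ ((i : ℤ) + 1 - k) with hu
  have hu0 : ∀ i, 0 < u i := fun i => zpow_pos hp _
  have hsm : ∀ i, MeasurableSet {y : V p | ‖qf p a y‖ ≤ u i} := fun i =>
    (isClosed_le (continuous_qf a).norm continuous_const).measurableSet
  have hpt : ∀ y ∈ {y : V p | (p : ℝ) ^ (-k) < ‖qf p a y‖},
      ENNReal.ofReal (‖qf p a y‖ ^ (-γ - 2)) ≤ ∑' i : ℕ,
        {y : V p | ‖qf p a y‖ ≤ u i}.indicator (fun _ => ENNReal.ofReal (u i ^ (-γ - 2))) y := by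
    intro y hy
    have hy' : (p : ℝ) ^ (-k) < ‖qf p a y‖ := hy
    have hy0 : qf p a y ≠ 0 := norm_pos_iff.1 ((zpow_pos hp _).trans hy')
    obtain ⟨n, hn⟩ := exists_norm_eq_zpow hy0
    rw [hn, zpow_lt_zpow_iff_right₀ one_lt_prime] at hy'
    have hun : u (n + k - 1).toNat = ‖qf p a y‖ := by
      have hi : ((n + k - 1).toNat : ℤ) + 1 - k = n := by omega
      simp only [hu, hi, hn]
    have hmem : y ∈ {y : V p | ‖qf p a y‖ ≤ u (n + k - 1).toNat} := hun.ge
    refine le_trans (le_of_eq ?_) (ENNReal.le_tsum (n + k - 1).toNat)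
    rw [indicator_of_mem hmem, hun]
  have hsms : MeasurableSet {y : V p | (p : ℝ) ^ (-k) < ‖qf p a y‖} :=
    (isOpen_lt continuous_const (continuous_qf a).norm).measurableSet
  have hq : (p : ℝ) ^ (-γ) < 1 := Real.rpow_lt_one_of_one_lt_of_neg one_lt_prime (neg_lt_zero.2 hγ)
  have hq0 : 0 < (p : ℝ) ^ (-γ) := by positivity
  calc _ ≤ ∫⁻ y in {y : V p | (p : ℝ) ^ (-k) < ‖qf p a y‖}, ∑' i : ℕ,
        {y : V p | ‖qf p a y‖ ≤ u i}.indicator (fun _ => ENNReal.ofReal (u i ^ (-γ - 2))) y ∂μ :=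
        setLIntegral_mono' hsms hpt
    _ ≤ ∫⁻ y, ∑' i : ℕ,
        {y : V p | ‖qf p a y‖ ≤ u i}.indicator (fun _ => ENNReal.ofReal (u i ^ (-γ - 2))) y ∂μ :=
        setLIntegral_le_lintegral _ _
    _ = ∑' i : ℕ, ENNReal.ofReal (u i ^ (-γ - 2)) * μ {y : V p | ‖qf p a y‖ ≤ u i} := by
        rw [lintegral_tsum fun i => (measurable_const.indicator (hsm i)).aemeasurable]
        simp_rw [lintegral_indicator_const (hsm _)]
    _ ≤ ∑' i : ℕ, ENNReal.ofReal ((p : ℝ) ^ 2 * ((p : ℝ) ^ k) ^ γ * ((p : ℝ) ^ (-γ)) ^ i) := by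
        refine ENNReal.tsum_le_tsum fun i => ?_
        refine (mul_le_mul_right (measure_norm_qf_le hμ ha (hu0 i)) _).trans ?_
        rw [← ENNReal.ofReal_mul (by have := hu0 i; positivity)]
        refine ENNReal.ofReal_le_ofReal ?_
        have e1 : u i ^ (-γ - 2) * (p * u i) ^ 2 = (p : ℝ) ^ 2 * u i ^ (-γ) := by
          have : u i ^ (-γ - 2) * u i ^ 2 = u i ^ (-γ) := by
            rw [← Real.rpow_two, ← Real.rpow_add (hu0 i)]
            congr 1
            ring
          rw [← this]
          ring
        have e2 : u i ^ (-γ) = ((p : ℝ) ^ k) ^ γ * ((p : ℝ) ^ (-γ)) ^ i * (p : ℝ) ^ (-γ) := by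
          simp only [hu]
          rw [← Real.rpow_intCast, ← Real.rpow_intCast, ← Real.rpow_natCast, ← Real.rpow_mul hp.le,
            ← Real.rpow_mul hp.le, ← Real.rpow_mul hp.le, ← Real.rpow_add hp, ← Real.rpow_add hp]
          congr 1
          push_cast
          ring
        rw [e1, e2, mul_assoc ((p : ℝ) ^ 2) (((p : ℝ) ^ k) ^ γ)]
        refine mul_le_mul_of_nonneg_left ?_ (by positivity)
        exact mul_le_of_le_one_right (by positivity) hq.le
    _ = _ := by
        rw [← ENNReal.ofReal_tsum_of_nonneg (fun i => by positivity)
          ((summable_geometric_of_lt_one hq0.le hq).mul_left ((p : ℝ) ^ 2 * ((p : ℝ) ^ k) ^ γ)), tsum_mul_left,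
          tsum_geometric_of_lt_one hq0.le hq]
        congr 1
        ring

lemma measurable_ballInd (a k : ℤ) : Measurable (ballInd p a k) :=
  Measurable.ite (isClosed_le (continuous_qf a).norm continuous_const).measurableSet
    measurable_const measurable_const

lemma measurable_kernel (a k : ℤ) (γ : ℝ) (x : V p) : Measurable fun y : V p =>
    ENNReal.ofReal (|ballInd p a k (x - y) - ballInd p a k x| * ‖qf p a y‖ ^ (-γ - 2)) := by
  have h : Measurable fun y : V p => ballInd p a k (x - y) - ballInd p a k x :=
    ((measurable_ballInd a k).comp (measurable_const.sub measurable_id)).sub measurable_const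
  exact (h.norm.mul (measurable_norm_qf_rpow a _)).ennreal_ofReal

lemma ballInd_nonneg (a k : ℤ) (x : V p) : 0 ≤ ballInd p a k x := by
  rw [ballInd]
  split_ifs <;> norm_num

lemma ballInd_le_one (a k : ℤ) (x : V p) : ballInd p a k x ≤ 1 := by
  rw [ballInd]
  split_ifs <;> norm_num

lemma lintegral_ballInd_sub_le_of_le (hμ : μ {x : V p | ‖x‖ ≤ 1} = 1) {a : ℤ} (ha : IsQNR p a)
    {γ : ℝ} (hγ : 0 < γ) {k : ℤ} {x : V p} (hx : ‖qf p a x‖ ≤ (p : ℝ) ^ (-k)) :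
    μ (dualBall p a k) * ∫⁻ y, ENNReal.ofReal
        (|ballInd p a k (x - y) - ballInd p a k x| * ‖qf p a y‖ ^ (-γ - 2)) ∂μ ≤
      ENNReal.ofReal ((p : ℝ) ^ 4 * (1 - (p : ℝ) ^ (-γ))⁻¹ * ((p : ℝ) ^ k) ^ (γ + 2)) := by
  have hp := pos_prime (p := p)
  have hsm : MeasurableSet {y : V p | (p : ℝ) ^ (-k) < ‖qf p a y‖} :=
    (isOpen_lt continuous_const (continuous_qf a).norm).measurableSet
  have h : ∫⁻ y, ENNReal.ofReal
      (|ballInd p a k (x - y) - ballInd p a k x| * ‖qf p a y‖ ^ (-γ - 2)) ∂μ ≤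
      ENNReal.ofReal ((p : ℝ) ^ 2 * (1 - (p : ℝ) ^ (-γ))⁻¹ * ((p : ℝ) ^ k) ^ γ) := by
    refine le_trans ?_ (lintegral_tail_le hμ ha hγ k)
    rw [← lintegral_indicator hsm]
    refine lintegral_mono fun y => ?_
    by_cases hy : ‖qf p a y‖ ≤ (p : ℝ) ^ (-k)
    · rw [ballInd, ballInd, if_pos hx, if_pos (norm_qf_sub_le ha hx hy), sub_self, abs_zero,
        zero_mul, ENNReal.ofReal_zero]
      exact zero_le
    · have hmem : y ∈ {y : V p | (p : ℝ) ^ (-k) < ‖qf p a y‖} := not_le.1 hy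
      rw [indicator_of_mem hmem]
      refine ENNReal.ofReal_le_ofReal (mul_le_of_le_one_left (by positivity) ?_)
      rw [abs_le]
      constructor <;>
        linarith [ballInd_nonneg a k (x - y), ballInd_le_one a k (x - y), ballInd_nonneg a k x,
          ballInd_le_one a k x]
  refine (mul_le_mul' (measure_dualBall_le hμ ha k) h).trans ?_
  rw [← ENNReal.ofReal_mul (by positivity)]
  refine ENNReal.ofReal_le_ofReal (le_of_eq ?_)
  rw [Real.rpow_add (zpow_pos hp k), Real.rpow_two]
  ring

lemma lintegral_ballInd_sub_le_of_lt (hμ : μ {x : V p | ‖x‖ ≤ 1} = 1) {a : ℤ} (ha : IsQNR p a)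
    {γ : ℝ} (hγ : 0 < γ) {k : ℤ} {x : V p} (hx : (p : ℝ) ^ (-k) < ‖qf p a x‖) :
    μ (dualBall p a k) * ∫⁻ y, ENNReal.ofReal
        (|ballInd p a k (x - y) - ballInd p a k x| * ‖qf p a y‖ ^ (-γ - 2)) ∂μ ≤
      ENNReal.ofReal ((p : ℝ) ^ 4 * ‖qf p a x‖ ^ (-γ - 2)) := by
  have hp := pos_prime (p := p)
  have hx0 : 0 < ‖qf p a x‖ := (zpow_pos hp _).trans hx
  set S : Set (V p) := {y : V p | ‖qf p a y‖ ≤ (p : ℝ) ^ (-k)}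
  have hS : MeasurableSet S := (isClosed_le (continuous_qf a).norm continuous_const).measurableSet
  have hmem : ∀ y, ‖qf p a (x - y)‖ ≤ (p : ℝ) ^ (-k) ↔ y ∈ (fun y => y + -x) ⁻¹' S := fun y => by
    rw [← qf_neg, neg_sub, sub_eq_add_neg]
    rfl
  have hT : MeasurableSet ((fun y => y + -x) ⁻¹' S) := (measurable_id.add_const _) hS
  have h : ∫⁻ y, ENNReal.ofReal
      (|ballInd p a k (x - y) - ballInd p a k x| * ‖qf p a y‖ ^ (-γ - 2)) ∂μ ≤
      ENNReal.ofReal (‖qf p a x‖ ^ (-γ - 2)) * ENNReal.ofReal ((p * (p : ℝ) ^ (-k)) ^ 2) := by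
    refine le_trans ?_ (mul_le_mul_right (measure_norm_qf_le hμ ha (zpow_pos hp (-k))) _)
    rw [← measure_preimage_add_right μ (-x), ← lintegral_indicator_const hT]
    refine lintegral_mono fun y => ?_
    rw [ballInd, ballInd, if_neg hx.not_ge, sub_zero]
    by_cases hy : ‖qf p a (x - y)‖ ≤ (p : ℝ) ^ (-k)
    · rw [if_pos hy, indicator_of_mem ((hmem y).1 hy), abs_one, one_mul]
      refine ENNReal.ofReal_le_ofReal (Real.rpow_le_rpow_of_nonpos hx0 ?_ (by linarith))
      by_contra! hlt
      have := norm_qf_add_le ha (hy.trans (le_max_left _ ‖qf p a y‖))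
        (le_max_right ((p : ℝ) ^ (-k)) ‖qf p a y‖)
      rw [sub_add_cancel] at this
      exact this.not_gt (max_lt hx hlt)
    · rw [if_neg hy, abs_zero, zero_mul, ENNReal.ofReal_zero]
      exact zero_le
  refine (mul_le_mul' (measure_dualBall_le hμ ha k) h).trans ?_
  rw [← ENNReal.ofReal_mul (by positivity), ← ENNReal.ofReal_mul (by positivity)]
  refine ENNReal.ofReal_le_ofReal (le_of_eq ?_)
  have e : (p : ℝ) ^ k * (p : ℝ) ^ (-k) = 1 := by rw [← zpow_add₀ hp.ne', add_neg_cancel, zpow_zero]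
  linear_combination (‖qf p a x‖ ^ (-γ - 2) * (p : ℝ) ^ 4) *
    ((p : ℝ) ^ k * (p : ℝ) ^ (-k) + 1) * e

variable (p) in
/-- A constant bounding the action of the operator on the normalised indicator of a ball. -/
def levelConst (γ : ℝ) : ℝ := (p : ℝ) ^ 4 * (1 + (1 - (p : ℝ) ^ (-γ))⁻¹)

lemma inv_one_sub_rpow_pos {γ : ℝ} (hγ : 0 < γ) : 0 < (1 - (p : ℝ) ^ (-γ))⁻¹ :=
  inv_pos.2 (sub_pos.2 (Real.rpow_lt_one_of_one_lt_of_neg one_lt_prime (neg_lt_zero.2 hγ)))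

lemma levelConst_pos {γ : ℝ} (hγ : 0 < γ) : 0 < levelConst p γ :=
  mul_pos (pow_pos pos_prime 4) (add_pos one_pos (inv_one_sub_rpow_pos hγ))

lemma lintegral_ballInd_sub_le_zpow (hμ : μ {x : V p | ‖x‖ ≤ 1} = 1) {a : ℤ} (ha : IsQNR p a)
    {γ : ℝ} (hγ : 0 < γ) (k : ℤ) (x : V p) :
    μ (dualBall p a k) * ∫⁻ y, ENNReal.ofReal
        (|ballInd p a k (x - y) - ballInd p a k x| * ‖qf p a y‖ ^ (-γ - 2)) ∂μ ≤
      ENNReal.ofReal (levelConst p γ * ((p : ℝ) ^ k) ^ (γ + 2)) := by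
  have hp := pos_prime (p := p)
  have hc := inv_one_sub_rpow_pos (p := p) hγ
  rcases le_or_gt ‖qf p a x‖ ((p : ℝ) ^ (-k)) with hx | hx
  · refine (lintegral_ballInd_sub_le_of_le hμ ha hγ hx).trans (ENNReal.ofReal_le_ofReal ?_)
    rw [levelConst]
    gcongr
    linarith
  · refine (lintegral_ballInd_sub_le_of_lt hμ ha hγ hx).trans (ENNReal.ofReal_le_ofReal ?_)
    have h1 := Real.rpow_le_rpow_of_nonpos (zpow_pos hp _) hx.le (by linarith : -γ - 2 ≤ 0)
    have h2 : ((p : ℝ) ^ (-k)) ^ (-γ - 2) = ((p : ℝ) ^ k) ^ (γ + 2) := by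
      rw [zpow_neg, Real.inv_rpow (by positivity), ← Real.rpow_neg (by positivity)]
      congr 1
      ring
    rw [h2] at h1
    rw [levelConst]
    gcongr
    exact le_mul_of_one_le_right (by positivity) (by linarith)

lemma lintegral_ballInd_sub_le_norm_qf (hμ : μ {x : V p | ‖x‖ ≤ 1} = 1) {a : ℤ} (ha : IsQNR p a)
    {γ : ℝ} (hγ : 0 < γ) (k : ℤ) {x : V p} (hx0 : 0 < ‖qf p a x‖) :
    μ (dualBall p a k) * ∫⁻ y, ENNReal.ofReal
        (|ballInd p a k (x - y) - ballInd p a k x| * ‖qf p a y‖ ^ (-γ - 2)) ∂μ ≤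
      ENNReal.ofReal (levelConst p γ * ‖qf p a x‖ ^ (-γ - 2)) := by
  have hp := pos_prime (p := p)
  have hc := inv_one_sub_rpow_pos (p := p) hγ
  rcases le_or_gt ‖qf p a x‖ ((p : ℝ) ^ (-k)) with hx | hx
  · refine (lintegral_ballInd_sub_le_zpow hμ ha hγ k x).trans (ENNReal.ofReal_le_ofReal ?_)
    have h1 := Real.rpow_le_rpow_of_nonpos hx0 hx (by linarith : -γ - 2 ≤ 0)
    have h2 : ((p : ℝ) ^ (-k)) ^ (-γ - 2) = ((p : ℝ) ^ k) ^ (γ + 2) := by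
      rw [zpow_neg, Real.inv_rpow (by positivity), ← Real.rpow_neg (by positivity)]
      congr 1
      ring
    rw [h2] at h1
    exact mul_le_mul_of_nonneg_left h1 (levelConst_pos hγ).le
  · refine (lintegral_ballInd_sub_le_of_lt hμ ha hγ hx).trans (ENNReal.ofReal_le_ofReal ?_)
    rw [levelConst]
    gcongr
    exact le_mul_of_one_le_right (by positivity) (by linarith)

lemma enorm_integral_heatZ_le (hμ : μ {x : V p | ‖x‖ ≤ 1} = 1) {a : ℤ} (ha : IsQNR p a)
    {χ : ℚ_[p] → ℂ} (hχ : IsStdChar p χ) {κ α γ t : ℝ} (hτ : 0 < κ * t) (hα : 0 < α) (x : V p) :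
    ‖∫ y, (heatZ p μ χ a κ α (x - y) t - heatZ p μ χ a κ α x t) *
        ((‖qf p a y‖ ^ (-γ - 2) : ℝ) : ℂ) ∂μ‖ₑ ≤
      ∑' k : ℤ, ENNReal.ofReal (coef p (κ * t) α k) * (μ (dualBall p a k) * ∫⁻ y, ENNReal.ofReal
        (|ballInd p a k (x - y) - ballInd p a k x| * ‖qf p a y‖ ^ (-γ - 2)) ∂μ) := by
  refine (enorm_integral_le_lintegral_enorm _).trans ?_
  have hpt : ∀ y, ‖(heatZ p μ χ a κ α (x - y) t - heatZ p μ χ a κ α x t) *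
      ((‖qf p a y‖ ^ (-γ - 2) : ℝ) : ℂ)‖ₑ ≤
      ∑' k : ℤ, ENNReal.ofReal (coef p (κ * t) α k) * (μ (dualBall p a k) * ENNReal.ofReal
        (|ballInd p a k (x - y) - ballInd p a k x| * ‖qf p a y‖ ^ (-γ - 2))) := fun y => by
    have h := ((hasSum_heatZ hμ ha hχ hτ hα (x - y)).sub (hasSum_heatZ hμ ha hχ hτ hα x)).mul_right
      ((‖qf p a y‖ ^ (-γ - 2) : ℝ) : ℂ)
    rw [← h.tsum_eq]
    refine enorm_tsum_le_tsum_enorm.trans (ENNReal.tsum_le_tsum fun k => le_of_eq ?_)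
    have hc := coef_nonneg (p := p) hτ hα k
    rw [← Complex.ofReal_sub, ← Complex.ofReal_mul, ← ofReal_norm, Complex.norm_real,
      ← ENNReal.ofReal_toReal (measure_dualBall_ne_top hμ ha k), ← Measure.real,
      ← ENNReal.ofReal_mul measureReal_nonneg, ← ENNReal.ofReal_mul hc, ← mul_sub, ← mul_sub,
      norm_mul, norm_mul, norm_mul, Real.norm_of_nonneg hc, Real.norm_of_nonneg measureReal_nonneg,
      Real.norm_eq_abs, Real.norm_of_nonneg (by positivity : 0 ≤ ‖qf p a y‖ ^ (-γ - 2)),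
      mul_assoc, mul_assoc]
  refine (lintegral_mono hpt).trans (le_of_eq ?_)
  rw [lintegral_tsum fun k =>
    (((measurable_kernel a k γ x).const_mul _).const_mul _).aemeasurable]
  refine tsum_congr fun k => ?_
  rw [lintegral_const_mul _ ((measurable_kernel a k γ x).const_mul _),
    lintegral_const_mul _ (measurable_kernel a k γ x)]

lemma norm_le_of_enorm_le_ofReal {z : ℂ} {r : ℝ} (hr : 0 ≤ r) (h : ‖z‖ₑ ≤ ENNReal.ofReal r) :
    ‖z‖ ≤ r := by
  rwa [← ofReal_norm, ENNReal.ofReal_le_ofReal_iff hr] at h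

/-- The decay of `f(∂,γ)Z_t` in the space variable, uniformly in time. -/
lemma norm_integral_heatZ_le_norm_qf (hμ : μ {x : V p | ‖x‖ ≤ 1} = 1) {a : ℤ} (ha : IsQNR p a)
    {χ : ℚ_[p] → ℂ} (hχ : IsStdChar p χ) {κ α γ t : ℝ} (hτ : 0 < κ * t) (hα : 0 < α) (hγ : 0 < γ)
    {x : V p} (hx : 0 < ‖qf p a x‖) :
    ‖∫ y, (heatZ p μ χ a κ α (x - y) t - heatZ p μ χ a κ α x t) *
        ((‖qf p a y‖ ^ (-γ - 2) : ℝ) : ℂ) ∂μ‖ ≤ levelConst p γ * ‖qf p a x‖ ^ (-γ - 2) := by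
  have hc := levelConst_pos (p := p) hγ
  refine norm_le_of_enorm_le_ofReal (by positivity)
    ((enorm_integral_heatZ_le hμ ha hχ hτ hα x).trans ?_)
  refine (ENNReal.tsum_le_tsum fun k =>
    mul_le_mul_right (lintegral_ballInd_sub_le_norm_qf hμ ha hγ k hx) _).trans ?_
  have h := hasSum_coef (p := p) hτ hα
  rw [ENNReal.tsum_mul_right, ← ENNReal.ofReal_tsum_of_nonneg (coef_nonneg hτ hα) h.summable,
    h.tsum_eq, ENNReal.ofReal_one, one_mul]

/-- The uniform bound of `f(∂,γ)Z_t` at time `t`. -/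
lemma exists_norm_integral_heatZ_le (hμ : μ {x : V p | ‖x‖ ≤ 1} = 1) {a : ℤ} (ha : IsQNR p a)
    {χ : ℚ_[p] → ℂ} (hχ : IsStdChar p χ) {α γ : ℝ} (hα : 0 < α) (hγ : 0 < γ) :
    ∃ C : ℝ, 0 < C ∧ ∀ (κ t : ℝ) (x : V p), 0 < κ * t →
      ‖∫ y, (heatZ p μ χ a κ α (x - y) t - heatZ p μ χ a κ α x t) *
        ((‖qf p a y‖ ^ (-γ - 2) : ℝ) : ℂ) ∂μ‖ ≤ C * (κ * t) ^ (-((γ + 2) / α)) := by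
  have hc := levelConst_pos (p := p) hγ
  obtain ⟨C, hC0, hC⟩ := exists_tsum_rpow_mul_coef_le p hα (by linarith : 0 < γ + 2)
  refine ⟨levelConst p γ * C, mul_pos hc hC0, fun κ t x hτ => ?_⟩
  obtain ⟨hs, hle⟩ := hC _ hτ
  refine norm_le_of_enorm_le_ofReal (by positivity)
    ((enorm_integral_heatZ_le hμ ha hχ hτ hα x).trans ?_)
  refine (ENNReal.tsum_le_tsum fun k =>
    mul_le_mul_right (lintegral_ballInd_sub_le_zpow hμ ha hγ k x) _).trans ?_
  have e : ∀ k : ℤ, ENNReal.ofReal (coef p (κ * t) α k) *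
      ENNReal.ofReal (levelConst p γ * ((p : ℝ) ^ k) ^ (γ + 2)) =
      ENNReal.ofReal (levelConst p γ * (((p : ℝ) ^ k) ^ (γ + 2) * coef p (κ * t) α k)) :=
    fun k => by
      rw [← ENNReal.ofReal_mul (coef_nonneg hτ hα k)]
      congr 1
      ring
  simp_rw [e]
  rw [← ENNReal.ofReal_tsum_of_nonneg (fun k => mul_nonneg hc.le
    (mul_nonneg (Real.rpow_nonneg (zpow_nonneg pos_prime.le k) _) (coef_nonneg hτ hα k)))
    (hs.mul_left _), tsum_mul_left, mul_assoc]
  exact ENNReal.ofReal_le_ofReal (mul_le_mul_of_nonneg_left hle hc.le)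

end Operator

lemma rpow_neg_le_of_le_two_mul {r v e : ℝ} (hr : 0 < r) (hv : 0 < v) (he : 0 ≤ e)
    (h : v ≤ 2 * r) : r ^ (-e) ≤ 2 ^ e * v ^ (-e) := by
  have h1 := Real.rpow_le_rpow_of_nonpos hv h (neg_nonpos.2 he)
  rw [Real.mul_rpow two_pos.le hr.le, Real.rpow_neg two_pos.le, inv_mul_le_iff₀ (by positivity)]
    at h1
  exact h1

variable (p)

/-- for `0 < γ ≤ α` there is `C > 0` with
`|(f(∂,γ)Z_t)(x)| ≤ C (t^{1/(2α)} + ‖x‖_p)^{−2γ−4}` for all `x`, `t > 0`. -/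
theorem statement11
    (hp : p ≠ 2) (a : ℤ) (ha : IsQNR p a)
    (μ : Measure (V p)) [μ.IsAddHaarMeasure] (hμ : μ {x : V p | ‖x‖ ≤ 1} = 1)
    (χ : ℚ_[p] → ℂ) (hχ : IsStdChar p χ)
    (κ α γ : ℝ) (hκ : 0 < κ) (hα : 0 < α) (hγ : 0 < γ) (hγα : γ ≤ α) :
    ∃ C : ℝ, 0 < C ∧ ∀ (x : V p) (t : ℝ), 0 < t →
      ‖fop p μ a γ (fun y => heatZ p μ χ a κ α y t) x‖ ≤
        C * (t ^ (1 / (2 * α)) + ‖x‖) ^ (-(2 * γ) - 4) := by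
  have hp := pos_prime (p := p)
  have hL := levelConst_pos (p := p) hγ
  obtain ⟨C, hC0, hC⟩ := exists_norm_integral_heatZ_le (μ := μ) hμ ha hχ hα hγ
  set K : ℝ := (1 - (p : ℝ) ^ γ) / (1 - (p : ℝ) ^ (-γ - 2)) with hK
  set A : ℝ := C * κ ^ (-((γ + 2) / α)) with hA
  set B : ℝ := levelConst p γ * (p : ℝ) ^ (γ + 2) with hB
  have hA0 : 0 < A := by positivity
  have hB0 : 0 < B := by positivity
  refine ⟨(|K| + 1) * ((A + B) * 2 ^ (2 * γ + 4)), by positivity, fun x t ht => ?_⟩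
  set s : ℝ := t ^ (1 / (2 * α)) with hs
  have hs0 : 0 < s := by positivity
  have hτ : 0 < κ * t := mul_pos hκ ht
  have hv : 0 < s + ‖x‖ := by positivity
  have he : -(2 * γ) - 4 = -(2 * γ + 4) := by ring
  have key : ‖∫ y, (heatZ p μ χ a κ α (x - y) t - heatZ p μ χ a κ α x t) *
      ((‖qf p a y‖ ^ (-γ - 2) : ℝ) : ℂ) ∂μ‖ ≤
      (A + B) * (2 ^ (2 * γ + 4) * (s + ‖x‖) ^ (-(2 * γ + 4))) := by
    rcases le_or_gt ‖x‖ s with hx | hx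
    · have h1 : (κ * t) ^ (-((γ + 2) / α)) = κ ^ (-((γ + 2) / α)) * s ^ (-(2 * γ + 4)) := by
        rw [Real.mul_rpow hκ.le ht.le, hs, ← Real.rpow_mul ht.le]
        congr 2
        field_simp
        ring
      have h2 := rpow_neg_le_of_le_two_mul hs0 hv (by linarith : 0 ≤ 2 * γ + 4)
        (by linarith : s + ‖x‖ ≤ 2 * s)
      calc _ ≤ A * s ^ (-(2 * γ + 4)) := by
            refine (hC κ t x hτ).trans (le_of_eq ?_)
            rw [h1, hA, mul_assoc]
        _ ≤ _ := mul_le_mul (by linarith) h2 (by positivity) (by positivity)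
    · have hx0 : 0 < ‖x‖ := hs0.trans hx
      have hq : ‖x‖ ^ 2 / p ≤ ‖qf p a x‖ :=
        (div_le_iff₀' hp).2 (norm_sq_le_mul_norm_qf ha x)
      have hq0 : 0 < ‖x‖ ^ 2 / p := by positivity
      have h1 : ‖qf p a x‖ ^ (-γ - 2) ≤ (p : ℝ) ^ (γ + 2) * ‖x‖ ^ (-(2 * γ + 4)) := by
        refine (Real.rpow_le_rpow_of_nonpos hq0 hq (by linarith)).trans (le_of_eq ?_)
        rw [show -γ - 2 = -(γ + 2) by ring, Real.div_rpow (by positivity) hp.le,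
          Real.rpow_neg hp.le, div_inv_eq_mul, ← Real.rpow_two, ← Real.rpow_mul hx0.le, mul_comm]
        congr 2
        ring
      have h2 := rpow_neg_le_of_le_two_mul hx0 hv (by linarith : 0 ≤ 2 * γ + 4)
        (by linarith : s + ‖x‖ ≤ 2 * ‖x‖)
      calc _ ≤ B * ‖x‖ ^ (-(2 * γ + 4)) := by
            refine (norm_integral_heatZ_le_norm_qf hμ ha hχ hτ hα hγ (hq0.trans_le hq)).trans ?_
            rw [hB, mul_assoc]
            exact mul_le_mul_of_nonneg_left h1 hL.le
        _ ≤ _ := mul_le_mul (by linarith) h2 (by positivity) (by positivity)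
  rw [fop, norm_mul, Complex.norm_real, Real.norm_eq_abs, he]
  calc _ ≤ (|K| + 1) * ((A + B) * (2 ^ (2 * γ + 4) * (s + ‖x‖) ^ (-(2 * γ + 4)))) :=
        mul_le_mul (by linarith) key (norm_nonneg _) (by positivity)
    _ = _ := by ring

end PadicParabolic
end
end

section
/- Let α > 0 and 0 ≤ λ < α, and let g(·,θ) ∈ 𝔐_{2λ} uniformly with respect to θ. Then the heat potential u₂(x,t,τ) = ∫_τ^t ∫_{ℚ_p⁴} Z(x − y, t − θ) g(y,θ) d⁴y dθ (for 0 ≤ τ < t) belongs to 𝔐_{2λ} uniformly with respect to t and τ; in particular u₂(·,t,τ) has the same exponent of local constancy as g and satisfies |u₂(x,t,τ)| ≤ C₀(1 + ‖x‖_p^{2λ}) with C₀ independent of t, τ. -/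
open MeasureTheory Real Filter Set

noncomputable section

namespace PadicParabolic

variable (p : ℕ) [Fact p.Prime]

/-- The space `𝔐_λ` of locally constant functions `φ : ℚ_p⁴ → ℂ` with
`|φ(x)| ≤ C (1 + ‖x‖_p^λ)` for some constant `C`. -/
def Mlam (lam : ℝ) (φ : V p → ℂ) : Prop :=
  IsLocallyConstant φ ∧ ∃ C : ℝ, ∀ x : V p, ‖φ x‖ ≤ C * (1 + ‖x‖ ^ lam)

/-- The heat potential `u₂(x,t,τ) = ∫_τ^t ∫ Z(x − y, t − θ) g(y,θ) d⁴y dθ`. -/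
def heatPot2 (μ : Measure (V p)) (χ : ℚ_[p] → ℂ) (a : ℤ) (κ α : ℝ)
    (g : V p → ℝ → ℂ) (x : V p) (t τ : ℝ) : ℂ :=
  ∫ θ in τ..t, ∫ y, heatZ p μ χ a κ α (x - y) (t - θ) * g y θ ∂μ

variable {p}

/-- The binary form `u² − a v²` is anisotropic: its norm is the square of the max-norm. -/
lemma IsQNR.norm_sq_sub_mul_sq {a : ℤ} (ha : IsQNR p a) (u v : ℚ_[p]) :
    ‖u ^ 2 - (a : ℚ_[p]) * v ^ 2‖ = max ‖u‖ ‖v‖ ^ 2 := by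
  have hna := ha.norm_intCast
  rcases lt_or_ge ‖v‖ ‖u‖ with h | h
  · have h2 : ‖v‖ ^ 2 < ‖u‖ ^ 2 := by gcongr
    rw [sub_eq_add_neg, IsUltrametricDist.norm_add_eq_max_of_norm_ne_norm]
    · simp only [norm_neg, norm_mul, norm_pow, hna, one_mul]
      rw [max_eq_left h2.le, max_eq_left h.le]
    · simp only [norm_neg, norm_mul, norm_pow, hna, one_mul]
      exact h2.ne'
  · rw [max_eq_right h]
    rcases eq_or_ne v 0 with rfl | hv
    · have : u = 0 := by simpa using h
      simp [this]
    · have hw : ‖u / v‖ ≤ 1 := by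
        rw [norm_div]; exact div_le_one_of_le₀ h (norm_nonneg _)
      let w : ℤ_[p] := ⟨u / v, hw⟩
      have h1 : ‖w ^ 2 - (a : ℤ_[p])‖ = 1 := by
        by_contra hne
        have hlt := lt_of_le_of_ne (PadicInt.norm_le_one (w ^ 2 - (a : ℤ_[p]))) hne
        have hmem : w ^ 2 - (a : ℤ_[p]) ∈ RingHom.ker (PadicInt.toZMod (p := p)) := by
          rw [PadicInt.ker_toZMod]
          exact PadicInt.mem_nonunits.2 hlt
        rw [RingHom.mem_ker, map_sub, map_pow, map_intCast, sub_eq_zero] at hmem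
        exact ha _ hmem
      have h2 : ‖(u / v) ^ 2 - (a : ℚ_[p])‖ = 1 := by
        rw [← h1, PadicInt.norm_def]; push_cast; rfl
      have h3 : u ^ 2 - (a : ℚ_[p]) * v ^ 2 = ((u / v) ^ 2 - (a : ℚ_[p])) * v ^ 2 := by
        field_simp
      rw [h3, norm_mul, h2, norm_pow, one_mul]

lemma norm_sq_ne_norm_mul_sq (u v : ℚ_[p]) (h : u ≠ 0 ∨ v ≠ 0) :
    ‖u‖ ^ 2 ≠ (p : ℝ)⁻¹ * ‖v‖ ^ 2 := by
  have hp1 : (1 : ℝ) < p := by exact_mod_cast (Fact.out : p.Prime).one_lt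
  have hp0 : (p : ℝ) ≠ 0 := by positivity
  intro he
  have hu : u ≠ 0 := by
    rintro rfl
    rcases h with h | h
    · exact h rfl
    · simp [hp0, h] at he
  have hv : v ≠ 0 := by
    rintro rfl
    simp [hu] at he
  rw [Padic.norm_eq_zpow_neg_valuation hu, Padic.norm_eq_zpow_neg_valuation hv,
    ← zpow_natCast, ← zpow_natCast, ← zpow_mul, ← zpow_mul, ← zpow_neg_one, ← zpow_add₀ hp0] at he
  have := zpow_right_injective₀ (by positivity) hp1.ne' he
  push_cast at this
  omega

lemma norm_le_max (ξ : V p) :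
    ‖ξ‖ ≤ max (max ‖ξ 3‖ ‖ξ 2‖) (max ‖ξ 1‖ ‖ξ 0‖) := by
  refine (pi_norm_le_iff_of_nonneg (by positivity)).2 fun i => ?_
  fin_cases i <;> simp

/-- Ellipticity of `f°`. -/
lemma norm_sq_le_norm_qfc {a : ℤ} (ha : IsQNR p a) (ξ : V p) :
    ‖ξ‖ ^ 2 ≤ p * ‖qfc p a ξ‖ := by
  have hp1 : (1 : ℝ) < p := by exact_mod_cast (Fact.out : p.Prime).one_lt
  have hp0 : (0 : ℝ) < p := by positivity
  rcases eq_or_ne ξ 0 with rfl | hξ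
  · simp [qfc]
  obtain ⟨u, hu⟩ : ∃ u : ℚ_[p], ‖u‖ = max ‖ξ 3‖ ‖ξ 2‖ := by
    rcases max_choice ‖ξ 3‖ ‖ξ 2‖ with h | h <;> exact ⟨_, h.symm⟩
  obtain ⟨v, hv⟩ : ∃ v : ℚ_[p], ‖v‖ = max ‖ξ 1‖ ‖ξ 0‖ := by
    rcases max_choice ‖ξ 1‖ ‖ξ 0‖ with h | h <;> exact ⟨_, h.symm⟩
  have hle : ‖ξ‖ ≤ max ‖u‖ ‖v‖ := by rw [hu, hv]; exact norm_le_max ξ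
  have huv : u ≠ 0 ∨ v ≠ 0 := by
    by_contra! hc
    rw [hc.1, hc.2] at hle
    exact hξ (by simpa using hle)
  have hq : qfc p a ξ = (ξ 3 ^ 2 - a * ξ 2 ^ 2) + (-(p : ℚ_[p])) * (ξ 1 ^ 2 - a * ξ 0 ^ 2) := by
    rw [qfc]; ring
  have h1 : ‖ξ 3 ^ 2 - a * ξ 2 ^ 2‖ = ‖u‖ ^ 2 := by rw [ha.norm_sq_sub_mul_sq, hu]
  have h2 : ‖(-(p : ℚ_[p])) * (ξ 1 ^ 2 - a * ξ 0 ^ 2)‖ = (p : ℝ)⁻¹ * ‖v‖ ^ 2 := by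
    rw [norm_mul, norm_neg, Padic.norm_p, ha.norm_sq_sub_mul_sq, hv]
  have h3 : ‖qfc p a ξ‖ = max (‖u‖ ^ 2) ((p : ℝ)⁻¹ * ‖v‖ ^ 2) := by
    rw [hq, IsUltrametricDist.norm_add_eq_max_of_norm_ne_norm, h1, h2]
    rw [h1, h2]
    exact norm_sq_ne_norm_mul_sq u v huv
  have h4 : ‖ξ‖ ^ 2 ≤ max ‖u‖ ‖v‖ ^ 2 := by gcongr
  refine h4.trans ?_
  rw [h3]
  rcases max_choice ‖u‖ ‖v‖ with h | h <;> rw [h]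
  · calc ‖u‖ ^ 2 ≤ p * ‖u‖ ^ 2 := le_mul_of_one_le_left (by positivity) hp1.le
      _ ≤ _ := by gcongr; exact le_max_left _ _
  · calc ‖v‖ ^ 2 = p * ((p : ℝ)⁻¹ * ‖v‖ ^ 2) := by field_simp
      _ ≤ _ := by gcongr; exact le_max_right _ _

lemma norm_add_le_of_le {b c : ℚ_[p]} {u : ℝ} (hb : ‖b‖ ≤ u) (hc : ‖c‖ ≤ u) : ‖b + c‖ ≤ u :=
  (IsUltrametricDist.norm_add_le_max b c).trans (max_le hb hc)

/-- The sets `{‖f°‖ ≤ u}` are stable under translations by small vectors. -/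
lemma norm_qfc_add_le_s14 {a : ℤ} (ha : IsQNR p a) {u : ℝ} {ξ η : V p}
    (hξ : ‖qfc p a ξ‖ ≤ u) (hη : p * ‖η‖ ^ 2 ≤ u) : ‖qfc p a (ξ + η)‖ ≤ u := by
  have hp1 : (1 : ℝ) < p := by exact_mod_cast (Fact.out : p.Prime).one_lt
  have hu : 0 ≤ u := (norm_nonneg _).trans hξ
  have hn : ∀ i, ‖η i‖ ≤ ‖η‖ := norm_le_pi_norm η
  have hx : ∀ i, ‖ξ i‖ ≤ ‖ξ‖ := norm_le_pi_norm ξ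
  have hξ2 : ‖ξ‖ ^ 2 ≤ p * u := (norm_sq_le_norm_qfc ha ξ).trans (by gcongr)
  have hη2 : ‖η‖ ^ 2 ≤ u := le_trans (le_mul_of_one_le_left (by positivity) hp1.le) hη
  have hprod : ‖ξ‖ * ‖η‖ ≤ u := by
    refine abs_le_of_sq_le_sq' ?_ hu |>.2
    have h5 : ‖ξ‖ ^ 2 * (p * ‖η‖ ^ 2) ≤ (p * u) * u := by gcongr
    have hp0 : (0 : ℝ) < p := by positivity
    nlinarith
  have hint : ∀ z : ℤ, ‖(z : ℚ_[p])‖ ≤ 1 := Padic.norm_int_le_one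
  have key : ∀ z : ℤ, ∀ i, ‖(z : ℚ_[p]) * (2 * ξ i * η i + η i ^ 2)‖ ≤ u := fun z i => by
    rw [norm_mul]
    have h6 : ‖2 * ξ i * η i + η i ^ 2‖ ≤ u := by
      refine norm_add_le_of_le ?_ ?_
      · rw [norm_mul, norm_mul]
        have h2 : ‖(2 : ℚ_[p])‖ ≤ 1 := by exact_mod_cast hint 2
        calc ‖(2 : ℚ_[p])‖ * ‖ξ i‖ * ‖η i‖ ≤ 1 * ‖ξ‖ * ‖η‖ := by gcongr <;> simp [hn, hx]
          _ ≤ u := by rwa [one_mul]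
      · rw [norm_pow]
        exact le_trans (by gcongr; exact hn i) hη2
    exact (mul_le_of_le_one_left (norm_nonneg _) (hint z)).trans h6
  have hq : qfc p a (ξ + η) = qfc p a ξ
      + ((((a * p : ℤ) : ℚ_[p]) * (2 * ξ 0 * η 0 + η 0 ^ 2)
        + ((-p : ℤ) : ℚ_[p]) * (2 * ξ 1 * η 1 + η 1 ^ 2))
        + (((-a : ℤ) : ℚ_[p]) * (2 * ξ 2 * η 2 + η 2 ^ 2)
        + ((1 : ℤ) : ℚ_[p]) * (2 * ξ 3 * η 3 + η 3 ^ 2))) := by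
    simp only [qfc, Pi.add_apply]; push_cast; ring
  rw [hq]
  exact norm_add_le_of_le hξ (norm_add_le_of_le (norm_add_le_of_le (key _ _) (key _ _))
    (norm_add_le_of_le (key _ _) (key _ _)))

/-- Numbers of the form `m / pⁿ` are dense in `ℚ_[p]`. -/
lemma denseRange_int_div_pow :
    DenseRange (fun q : ℤ × ℕ => (q.1 : ℚ_[p]) / (p : ℚ_[p]) ^ q.2) := by
  have hp0 : (p : ℚ_[p]) ≠ 0 := by exact_mod_cast (Fact.out : p.Prime).ne_zero
  intro x
  obtain ⟨n, hn⟩ : ∃ n : ℕ, ‖x * (p : ℚ_[p]) ^ n‖ ≤ 1 := by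
    have hp1 : (1 : ℝ) < p := by exact_mod_cast (Fact.out : p.Prime).one_lt
    obtain ⟨n, hn⟩ := pow_unbounded_of_one_lt ‖x‖ hp1
    refine ⟨n, ?_⟩
    rw [norm_mul, norm_pow, Padic.norm_p, inv_pow]
    exact mul_inv_le_one_of_le₀ hn.le (by positivity)
  let y : ℤ_[p] := ⟨x * (p : ℚ_[p]) ^ n, hn⟩
  have hcont : Continuous (fun z : ℤ_[p] => (z : ℚ_[p]) / (p : ℚ_[p]) ^ n) :=
    continuous_subtype_val.div_const _
  have hxy : x = (fun z : ℤ_[p] => (z : ℚ_[p]) / (p : ℚ_[p]) ^ n) y := by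
    simp [y, hp0]
  rw [hxy]
  refine closure_mono ?_ (hcont.range_subset_closure_image_dense
    (PadicInt.denseRange_intCast (p := p)) ⟨y, rfl⟩)
  rintro _ ⟨_, ⟨m, rfl⟩, rfl⟩
  exact ⟨(m, n), by simp⟩

lemma IsStdChar.norm_eq_one_s14 {χ : ℚ_[p] → ℂ} (hχ : IsStdChar p χ) (x : ℚ_[p]) : ‖χ x‖ = 1 := by
  refine congrFun ((denseRange_int_div_pow (p := p)).equalizer (g := fun x => ‖χ x‖)
    (h := fun _ => (1 : ℝ)) hχ.1.norm continuous_const ?_) x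
  ext ⟨m, n⟩
  simp only [Function.comp_apply, hχ.2]
  have : 2 * (Real.pi : ℂ) * Complex.I * (m : ℂ) / (p : ℂ) ^ n
      = ((2 * Real.pi * m / p ^ n : ℝ) : ℂ) * Complex.I := by push_cast; ring
  rw [this, Complex.norm_exp_ofReal_mul_I]

lemma IsStdChar.map_add_s14 {χ : ℚ_[p] → ℂ} (hχ : IsStdChar p χ) (x y : ℚ_[p]) :
    χ (x + y) = χ x * χ y := by
  have hp0 : (p : ℚ_[p]) ≠ 0 := by exact_mod_cast (Fact.out : p.Prime).ne_zero
  have hp0' : (p : ℂ) ≠ 0 := by exact_mod_cast (Fact.out : p.Prime).ne_zero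
  have hc := hχ.1
  refine congrFun (((denseRange_int_div_pow (p := p)).prodMap
    (denseRange_int_div_pow (p := p))).equalizer
    (g := fun q : ℚ_[p] × ℚ_[p] => χ (q.1 + q.2)) (h := fun q => χ q.1 * χ q.2)
    (by fun_prop) (by fun_prop) ?_) (x, y)
  ext ⟨⟨m, n⟩, ⟨k, l⟩⟩
  simp only [Function.comp_apply, Prod.map, hχ.2]
  have h1 : (m : ℚ_[p]) / p ^ n + k / p ^ l =
      ((m * p ^ l + k * p ^ n : ℤ) : ℚ_[p]) / p ^ (n + l) := by
    push_cast; field_simp; ring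
  rw [h1, hχ.2, ← Complex.exp_add]
  congr 1
  push_cast
  field_simp
  ring

lemma IsStdChar.inv_ne_one {χ : ℚ_[p] → ℂ} (hχ : IsStdChar p χ) :
    χ ((p : ℚ_[p])⁻¹) ≠ 1 := by
  have hp0 : (p : ℂ) ≠ 0 := by exact_mod_cast (Fact.out : p.Prime).ne_zero
  have h := hχ.2 1 1
  simp only [Int.cast_one, pow_one, one_div, mul_one] at h
  rw [h]
  intro he
  obtain ⟨n, hn⟩ := Complex.exp_eq_one_iff.1 he
  have h2 : (1 : ℂ) = n * p := by
    have h3 := Complex.two_pi_I_ne_zero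
    rw [div_eq_iff hp0] at hn
    refine mul_right_cancel₀ h3 ?_
    linear_combination hn
  have h4 : (1 : ℤ) = n * p := by exact_mod_cast h2
  have h5 : (p : ℤ) ∣ 1 := ⟨n, by rw [h4]; ring⟩
  have := Int.le_of_dvd one_pos h5
  have : (p : ℤ) > 1 := by exact_mod_cast (Fact.out : p.Prime).one_lt
  omega

/-- The Fourier transform of the indicator of `{‖f°‖ ≤ u}` vanishes away from the origin. -/
lemma integral_char_qfc_eq_zero {a : ℤ} (ha : IsQNR p a) (μ : Measure (V p)) [μ.IsAddHaarMeasure]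
    {χ : ℚ_[p] → ℂ} (hχ : IsStdChar p χ) {u : ℝ} {x : V p} (hx : p ^ 3 ≤ u * ‖x‖ ^ 2) :
    ∫ ξ in {ξ : V p | ‖qfc p a ξ‖ ≤ u}, χ (∑ i, ξ i * x i) ∂μ = 0 := by
  have hp0 : (0 : ℝ) < p := by exact_mod_cast (Fact.out : p.Prime).pos
  have hp0' : (p : ℚ_[p]) ≠ 0 := by exact_mod_cast (Fact.out : p.Prime).ne_zero
  have hx0 : 0 < ‖x‖ := by
    rw [norm_pos_iff]; rintro rfl
    have : (0 : ℝ) < p ^ 3 := by positivity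
    simp at hx; linarith
  obtain ⟨i, hi⟩ : ∃ i, ‖x i‖ = ‖x‖ := by
    obtain ⟨i, -, hi⟩ := Finset.exists_mem_eq_sup' (s := Finset.univ) Finset.univ_nonempty
      (fun i => ‖x i‖)
    refine ⟨i, le_antisymm (norm_le_pi_norm x i) ?_⟩
    rw [← hi]
    exact (pi_norm_le_iff_of_nonneg ((norm_nonneg (x 0)).trans
      (Finset.le_sup' (fun i => ‖x i‖) (Finset.mem_univ 0)))).2
      fun j => Finset.le_sup' (fun i => ‖x i‖) (Finset.mem_univ j)
  have hxi : x i ≠ 0 := by rw [← norm_pos_iff, hi]; exact hx0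
  let η : V p := Pi.single i ((p : ℚ_[p]) * x i)⁻¹
  have hηx : ∑ j, η j * x j = (p : ℚ_[p])⁻¹ := by
    rw [Finset.sum_eq_single i]
    · simp only [η, Pi.single_eq_same]; field_simp
    · intro j _ hj; simp [η, hj]
    · simp
  have hηn : p * ‖η‖ ^ 2 ≤ u := by
    have : ‖η‖ = p / ‖x‖ := by
      simp only [η]
      rw [Pi.norm_single, norm_inv, norm_mul, Padic.norm_p, hi]
      field_simp
    rw [this, div_pow, ← mul_div_assoc, div_le_iff₀ (by positivity)]
    linarith [pow_succ (p : ℝ) 2, mul_comm ((p : ℝ) ^ 2) p]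
  have hmem : ∀ ξ : V p, ‖qfc p a (ξ + η)‖ ≤ u ↔ ‖qfc p a ξ‖ ≤ u := fun ξ => by
    refine ⟨fun h => ?_, fun h => norm_qfc_add_le_s14 ha h hηn⟩
    have := norm_qfc_add_le_s14 ha (η := -η) h (by rwa [norm_neg])
    rwa [add_neg_cancel_right] at this
  have hS : MeasurableSet {ξ : V p | ‖qfc p a ξ‖ ≤ u} :=
    (isClosed_le (continuous_qfc a).norm continuous_const).measurableSet
  rw [← integral_indicator hS]
  set F : V p → ℂ := {ξ : V p | ‖qfc p a ξ‖ ≤ u}.indicator fun ξ => χ (∑ i, ξ i * x i) with hF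
  have h1 : ∀ ξ, F (ξ + η) = χ (p : ℚ_[p])⁻¹ * F ξ := fun ξ => by
    simp only [hF, indicator, mem_ofPred_eq, hmem]
    split_ifs
    · rw [← hηx, ← hχ.map_add_s14]
      congr 1
      rw [← Finset.sum_add_distrib]
      exact Finset.sum_congr rfl fun j _ => by simp only [Pi.add_apply]; ring
    · simp
  have h2 : ∫ ξ, F ξ ∂μ = χ (p : ℚ_[p])⁻¹ * ∫ ξ, F ξ ∂μ := by
    rw [← integral_const_mul]
    simp_rw [← h1]
    exact (integral_add_right_eq_self F η).symm
  have h3 : (1 - χ (p : ℚ_[p])⁻¹) * ∫ ξ, F ξ ∂μ = 0 := by linear_combination h2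
  exact (mul_eq_zero.1 h3).resolve_left (sub_ne_zero.2 hχ.inv_ne_one.symm)

/-- The volume of the ball `{‖x‖² ≤ s}`. -/
def ballVol (μ : Measure (V p)) (s : ℝ) : ENNReal := μ {x : V p | ‖x‖ ^ 2 ≤ s}

lemma ballVol_mono (μ : Measure (V p)) : Monotone (ballVol μ) := fun _ _ h =>
  measure_mono fun _ hx => le_trans hx h

/-- Volumes of dual balls are inverse to each other up to a constant. -/
lemma exists_ballVol_mul_le (μ : Measure (V p)) [μ.IsAddHaarMeasure]
    (hμ : μ {x : V p | ‖x‖ ≤ 1} = 1) :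
    ∃ M : NNReal, ∀ s s' : ℝ, 0 < s → 0 < s' → s * s' ≤ p ^ 4 →
      ballVol μ s * ballVol μ s' ≤ M := by
  have hp1 : (1 : ℝ) < p := by exact_mod_cast (Fact.out : p.Prime).one_lt
  have hpp : (0 : ℝ) < p := by positivity
  have hp0' : (p : ℚ_[p]) ≠ 0 := by exact_mod_cast (Fact.out : p.Prime).ne_zero
  let e : V p ≃L[ℚ_[p]] V p := ContinuousLinearEquiv.smulLeft (Units.mk0 (p : ℚ_[p]) hp0')
  have he : ∀ x, ‖e x‖ = (p : ℝ)⁻¹ * ‖x‖ := fun x => by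
    have : e x = (p : ℚ_[p]) • x := rfl
    rw [this, norm_smul, Padic.norm_p]
  have : (μ.map e).IsAddHaarMeasure := e.isAddHaarMeasure_map μ
  obtain ⟨c, hc⟩ : ∃ c : NNReal, μ.map e = c • μ :=
    ⟨_, Measure.isAddLeftInvariant_eq_smul (μ.map e) μ⟩
  let B : ℤ → Set (V p) := fun n => {x | ‖x‖ ≤ (p : ℝ) ^ n}
  have hB : ∀ n, μ (B (n + 1)) = c * μ (B n) := fun n => by
    have h1 : e ⁻¹' (B n) = B (n + 1) := by
      ext x
      simp only [B, mem_preimage, mem_ofPred_eq, he]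
      rw [inv_mul_le_iff₀ hpp, zpow_add_one₀ hpp.ne', mul_comm]
    have hm : MeasurableSet (B n) :=
      (isClosed_le continuous_norm continuous_const).measurableSet
    rw [← h1, ← Measure.map_apply e.continuous.measurable hm, hc]
    rfl
  have hB0 : μ (B 0) = 1 := by simpa [B] using hμ
  have hc1 : 1 ≤ c := by
    have h1 := hB 0
    rw [hB0, mul_one] at h1
    have h2 : μ (B 0) ≤ μ (B (0 + 1)) := measure_mono fun x hx =>
      le_trans hx (zpow_le_zpow_right₀ hp1.le (by norm_num))
    rw [h1, hB0] at h2
    exact_mod_cast h2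
  have hc0 : c ≠ 0 := (zero_lt_one.trans_le hc1).ne'
  have hBn : ∀ n : ℤ, μ (B n) = ((c ^ n : NNReal) : ENNReal) := fun n => by
    induction n with
    | zero => simp [hB0]
    | succ k ih => rw [hB, ih, zpow_add_one₀ hc0, mul_comm, ENNReal.coe_mul]
    | pred k ih =>
      have h1 := hB (-(k : ℤ) - 1)
      rw [sub_add_cancel, ih] at h1
      rw [zpow_sub_one₀ hc0]
      rw [ENNReal.coe_mul, h1, mul_comm (c : ENNReal), mul_assoc, ← ENNReal.coe_mul,
        mul_inv_cancel₀ hc0, ENNReal.coe_one, mul_one]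
  have hp2 : (1 : ℝ) < (p : ℝ) ^ 2 := by nlinarith
  have hV : ∀ s : ℝ, 0 < s → ∃ n : ℤ, ((p : ℝ) ^ 2) ^ n ≤ s ∧
      ballVol μ s ≤ ((c ^ n : NNReal) : ENNReal) := fun s hs => by
    obtain ⟨n, hn, hn'⟩ := exists_mem_Ico_zpow hs hp2
    refine ⟨n, hn, ?_⟩
    rw [← hBn]
    refine measure_mono fun x hx => ?_
    have hx' : ‖x‖ ^ 2 < ((p : ℝ) ^ 2) ^ (n + 1) := lt_of_le_of_lt hx hn'
    rw [← zpow_natCast (p : ℝ), ← zpow_mul, mul_comm, zpow_mul, zpow_natCast] at hx'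
    have hx2 : ‖x‖ < (p : ℝ) ^ (n + 1) := lt_of_pow_lt_pow_left₀ 2 (by positivity) hx'
    refine (pi_norm_le_iff_of_nonneg (by positivity)).2 fun i => ?_
    rw [Padic.norm_le_pow_iff_norm_lt_pow_add_one]
    exact (norm_le_pi_norm x i).trans_lt hx2
  refine ⟨c ^ 2, fun s s' hs hs' hss => ?_⟩
  obtain ⟨n, hn, hn'⟩ := hV s hs
  obtain ⟨m, hm, hm'⟩ := hV s' hs'
  have hnm : n + m ≤ 2 := by
    have h1 : ((p : ℝ) ^ 2) ^ (n + m) ≤ ((p : ℝ) ^ 2) ^ (2 : ℤ) := by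
      rw [zpow_add₀ (by positivity)]
      calc _ ≤ s * s' := by gcongr
        _ ≤ p ^ 4 := hss
        _ = _ := by norm_cast; rw [← pow_mul]
    exact (zpow_le_zpow_iff_right₀ hp2).1 h1
  calc ballVol μ s * ballVol μ s' ≤ ((c ^ n : NNReal) : ENNReal) * ((c ^ m : NNReal) : ENNReal) :=
        mul_le_mul' hn' hm'
    _ = ((c ^ (n + m) : NNReal) : ENNReal) := by rw [zpow_add₀ hc0, ENNReal.coe_mul]
    _ ≤ ((c ^ 2 : NNReal) : ENNReal) := by
        refine ENNReal.coe_le_coe.2 ?_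
        exact_mod_cast zpow_le_zpow_right₀ hc1 hnm

/-- The layer-cake formula for the exponential. -/
lemma setIntegral_Ioi_indicator_exp_neg {c : ℝ} (hc : 0 ≤ c) :
    ∫ r in Ioi (0 : ℝ), (Ici c).indicator (fun r => Real.exp (-r)) r = Real.exp (-c) := by
  rw [setIntegral_indicator measurableSet_Ici, ← integral_exp_neg_Ioi c]
  refine setIntegral_congr_set ?_
  have h := ae_eq_set_inter (ae_eq_refl (Ioi (0 : ℝ)) (μ := volume))
    (Ioi_ae_eq_Ici (a := c) (μ := volume)).symm
  rwa [Ioi_inter_Ioi, max_eq_right hc] at h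

/-- The pointwise bound of the heat kernel (with `b = κ t`) by a superposition of normalized
indicators of balls. -/
lemma enorm_heatZ_le {a : ℤ} (ha : IsQNR p a) (μ : Measure (V p)) [μ.IsAddHaarMeasure]
    {χ : ℚ_[p] → ℂ} (hχ : IsStdChar p χ) {κ α t : ℝ} (hα : 0 < α) (hb : 0 < κ * t) (x : V p) :
    ‖heatZ p μ χ a κ α x t‖ₑ ≤ ∫⁻ r in Ioi (0 : ℝ), ENNReal.ofReal (Real.exp (-r)) *
      (ballVol μ (p * (r / (κ * t)) ^ (1 / α)) *
        {q : V p × ℝ | ‖q.1‖ ^ 2 * (q.2 / (κ * t)) ^ (1 / α) ≤ (p : ℝ) ^ 3}.indicator 1 (x, r)) := by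
  rw [heatZ]
  set b := κ * t with hbdef
  have hN : Continuous fun ξ : V p => b * ‖qfc p a ξ‖ ^ α :=
    continuous_const.mul ((continuous_qfc a).norm.rpow_const fun _ => Or.inr hα.le)
  have hχc : Continuous fun ξ : V p => χ (∑ i, ξ i * x i) := hχ.1.comp (by fun_prop)
  have hN0 : ∀ ξ : V p, 0 ≤ b * ‖qfc p a ξ‖ ^ α := fun ξ => by positivity
  set E : V p → ℝ := fun ξ => Real.exp (-(b * ‖qfc p a ξ‖ ^ α)) with hE
  by_cases hint : Integrable E μ
  swap
  · rw [integral_undef]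
    · simp
    · refine fun hc => hint (hc.norm.congr (Eventually.of_forall fun ξ => ?_))
      simp only [norm_mul, hχ.norm_eq_one_s14, one_mul, Complex.norm_real, Real.norm_eq_abs,
        Real.abs_exp, hE]
  set S : Set (V p × ℝ) := {q | b * ‖qfc p a q.1‖ ^ α ≤ q.2} with hS
  have hSm : MeasurableSet S :=
    (isClosed_le (hN.comp continuous_fst) continuous_snd).measurableSet
  set G : V p → ℝ → ℂ := fun ξ r => χ (∑ i, ξ i * x i) *
    ((S.indicator (fun q => Real.exp (-q.2)) (ξ, r) : ℝ) : ℂ) with hG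
  have hSi : ∀ ξ r, S.indicator (fun q => Real.exp (-q.2)) (ξ, r)
      = (Ici (b * ‖qfc p a ξ‖ ^ α)).indicator (fun r => Real.exp (-r)) r := fun ξ r => rfl
  have hGn : ∀ ξ r, ‖G ξ r‖
      = (Ici (b * ‖qfc p a ξ‖ ^ α)).indicator (fun r => Real.exp (-r)) r := fun ξ r => by
    simp only [hG, norm_mul, hχ.norm_eq_one_s14, one_mul, Complex.norm_real, hSi]
    exact Real.norm_of_nonneg (indicator_nonneg (fun _ _ => (Real.exp_pos _).le) _)
  have hexp : IntegrableOn (fun r : ℝ => Real.exp (-r)) (Ioi 0) := integrableOn_exp_neg_Ioi 0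
  have hGm : Measurable (Function.uncurry G) := by
    refine Measurable.mul (hχc.measurable.comp measurable_fst) ?_
    exact Complex.measurable_ofReal.comp
      ((Real.measurable_exp.comp measurable_snd.neg).indicator hSm)
  have hGint : Integrable (Function.uncurry G) (μ.prod (volume.restrict (Ioi 0))) := by
    rw [integrable_prod_iff hGm.aestronglyMeasurable]
    constructor
    · refine Eventually.of_forall fun ξ => ?_
      refine (hexp.integrable.indicator (measurableSet_Ici (a := b * ‖qfc p a ξ‖ ^ α))).mono'
        (hGm.comp measurable_prodMk_left).aestronglyMeasurable
        (Eventually.of_forall fun r => (hGn ξ r).le)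
    · refine hint.congr (Eventually.of_forall fun ξ => ?_)
      simp only [Function.uncurry_apply_pair, hGn, setIntegral_Ioi_indicator_exp_neg (hN0 ξ), hE]
  have h1 : ∫ ξ, χ (∑ i, ξ i * x i) * (E ξ : ℂ) ∂μ = ∫ r in Ioi (0 : ℝ), ∫ ξ, G ξ r ∂μ := by
    rw [← integral_integral_swap hGint]
    refine integral_congr_ae (Eventually.of_forall fun ξ => ?_)
    simp only [hG, hSi]
    rw [integral_const_mul, integral_complex_ofReal, setIntegral_Ioi_indicator_exp_neg (hN0 ξ)]
  have h2 : ∫ ξ, χ (∑ i, ξ i * x i) *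
      (Real.exp (-(b * ‖qfc p a ξ‖ ^ α)) : ℂ) ∂μ = ∫ r in Ioi (0 : ℝ), ∫ ξ, G ξ r ∂μ := h1
  rw [h2]
  refine (enorm_integral_le_lintegral_enorm _).trans ?_
  refine setLIntegral_mono' measurableSet_Ioi fun r (hr : 0 < r) => ?_
  set u : ℝ := (r / b) ^ (1 / α) with hu
  have hu0 : 0 < u := by positivity
  have hiff : ∀ ξ, (ξ, r) ∈ S ↔ ‖qfc p a ξ‖ ≤ u := fun ξ => by
    rw [hu, one_div, Real.le_rpow_inv_iff_of_pos (norm_nonneg _) (by positivity) hα,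
      le_div_iff₀ hb, mul_comm]
    rfl
  have hLm : MeasurableSet {ξ : V p | ‖qfc p a ξ‖ ≤ u} :=
    (isClosed_le (continuous_qfc a).norm continuous_const).measurableSet
  have h3 : ∫ ξ, G ξ r ∂μ = (Real.exp (-r) : ℂ) *
      ∫ ξ in {ξ : V p | ‖qfc p a ξ‖ ≤ u}, χ (∑ i, ξ i * x i) ∂μ := by
    rw [← integral_indicator hLm, ← integral_const_mul]
    refine integral_congr_ae (Eventually.of_forall fun ξ => ?_)
    simp only [hG, indicator, hiff, mem_ofPred_eq]
    split_ifs <;> simp [mul_comm]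
  rw [h3, enorm_mul]
  have h4 : ‖(Real.exp (-r) : ℂ)‖ₑ = ENNReal.ofReal (Real.exp (-r)) := by
    rw [← ofReal_norm, Complex.norm_real, Real.norm_eq_abs, Real.abs_exp]
  rw [h4]
  refine mul_le_mul_right ?_ _
  by_cases hx : ‖x‖ ^ 2 * u ≤ (p : ℝ) ^ 3
  · rw [indicator_of_mem (by exact hx), Pi.one_apply, mul_one]
    refine (enorm_integral_le_lintegral_enorm _).trans ?_
    simp only [← ofReal_norm, hχ.norm_eq_one_s14, ENNReal.ofReal_one]
    rw [setLIntegral_one]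
    exact measure_mono fun ξ hξ => (norm_sq_le_norm_qfc ha ξ).trans
      (mul_le_mul_of_nonneg_left hξ (Nat.cast_nonneg p))
  · rw [integral_char_qfc_eq_zero ha μ hχ (by rw [mul_comm]; exact (not_le.1 hx).le)]
    simp

/-- Uniform weighted `L¹` bound of the heat kernel. -/
lemma exists_lintegral_heatZ_le {a : ℤ} (ha : IsQNR p a) (μ : Measure (V p)) [μ.IsAddHaarMeasure]
    (hμ : μ {x : V p | ‖x‖ ≤ 1} = 1) {χ : ℚ_[p] → ℂ} (hχ : IsStdChar p χ)
    {κ α lam T : ℝ} (hκ : 0 < κ) (hα : 0 < α) (hlam0 : 0 ≤ lam) (hlam : lam < α) :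
    ∃ K : ENNReal, K < ⊤ ∧ ∀ t, 0 < t → t ≤ T →
      ∫⁻ z, ‖heatZ p μ χ a κ α z t‖ₑ * ENNReal.ofReal (1 + ‖z‖ ^ (2 * lam)) ∂μ ≤ K := by
  have hpp : (0 : ℝ) < p := by exact_mod_cast (Fact.out : p.Prime).pos
  obtain ⟨M, hM⟩ := exists_ballVol_mul_le μ hμ
  set D : ℝ := ((p : ℝ) ^ 3) ^ lam * (κ * T) ^ (lam / α) with hD
  have hI : IntegrableOn (fun r : ℝ => Real.exp (-r) * (1 + D * r ^ (-(lam / α)))) (Ioi 0) := by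
    have h1 : 0 < 1 - lam / α := by
      rw [sub_pos, div_lt_one hα]; exact hlam
    have h2 := (Real.GammaIntegral_convergent h1).const_mul D
    refine ((integrableOn_exp_neg_Ioi 0).add h2).congr_fun (fun r _ => ?_) measurableSet_Ioi
    simp only [Pi.add_apply]
    rw [show (1 - lam / α - 1) = -(lam / α) by ring]
    ring
  refine ⟨M * ∫⁻ r in Ioi (0 : ℝ),
    ENNReal.ofReal (Real.exp (-r) * (1 + D * r ^ (-(lam / α)))),
    ENNReal.mul_lt_top ENNReal.coe_lt_top hI.lintegral_lt_top, fun t ht htT => ?_⟩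
  have hb : 0 < κ * t := by positivity
  set w : V p → ENNReal := fun z => ENNReal.ofReal (1 + ‖z‖ ^ (2 * lam)) with hw
  have hwm : Measurable w := by fun_prop
  set u : ℝ → ℝ := fun r => (r / (κ * t)) ^ (1 / α) with hu
  have hum : Measurable u := by fun_prop
  set S : Set (V p × ℝ) := {q | ‖q.1‖ ^ 2 * u q.2 ≤ (p : ℝ) ^ 3} with hS
  have hSm : MeasurableSet S := measurableSet_le (by fun_prop) measurable_const
  set H : V p → ℝ → ENNReal := fun z r => ENNReal.ofReal (Real.exp (-r)) *
    (ballVol μ (p * u r) * S.indicator 1 (z, r)) with hH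
  have hHm : Measurable (Function.uncurry H) := by
    refine Measurable.mul (by fun_prop) (Measurable.mul ?_ ?_)
    · exact (ballVol_mono μ).measurable.comp (by fun_prop)
    · exact measurable_one.indicator hSm
  calc ∫⁻ z, ‖heatZ p μ χ a κ α z t‖ₑ * w z ∂μ
      ≤ ∫⁻ z, (∫⁻ r in Ioi (0 : ℝ), H z r) * w z ∂μ :=
        lintegral_mono fun z => mul_le_mul_left (enorm_heatZ_le ha μ hχ hα hb z) _
    _ = ∫⁻ z, (∫⁻ r in Ioi (0 : ℝ), H z r * w z) ∂μ := by
        refine lintegral_congr fun z => ?_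
        exact (lintegral_mul_const' _ _ ENNReal.ofReal_ne_top).symm
    _ = ∫⁻ r in Ioi (0 : ℝ), ∫⁻ z, H z r * w z ∂μ :=
        lintegral_lintegral_swap (hHm.mul (hwm.comp measurable_fst)).aemeasurable
    _ ≤ ∫⁻ r in Ioi (0 : ℝ),
          M * ENNReal.ofReal (Real.exp (-r) * (1 + D * r ^ (-(lam / α)))) := by
        refine setLIntegral_mono' measurableSet_Ioi fun r (hr : 0 < r) => ?_
        have hu0 : 0 < u r := by simp only [hu]; positivity
        set W : ENNReal := ENNReal.ofReal (1 + D * r ^ (-(lam / α))) with hW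
        have hball : MeasurableSet {z : V p | ‖z‖ ^ 2 ≤ p ^ 3 / u r} :=
          measurableSet_le (by fun_prop) measurable_const
        have hpt : ∀ z, H z r * w z ≤ (ENNReal.ofReal (Real.exp (-r)) * ballVol μ (p * u r) * W) *
            {z : V p | ‖z‖ ^ 2 ≤ p ^ 3 / u r}.indicator 1 z := fun z => by
          by_cases hz : ‖z‖ ^ 2 ≤ p ^ 3 / u r
          · have hzS : (z, r) ∈ S := (le_div_iff₀ hu0).1 hz
            rw [indicator_of_mem (by exact hz)]
            simp only [hH, indicator_of_mem hzS, Pi.one_apply, mul_one]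
            refine mul_le_mul_right (ENNReal.ofReal_le_ofReal ?_) _
            gcongr
            calc ‖z‖ ^ (2 * lam) = (‖z‖ ^ 2) ^ lam := by
                  rw [Real.rpow_mul (norm_nonneg _)]; norm_num
              _ ≤ (p ^ 3 / u r) ^ lam := by gcongr
              _ = ((p : ℝ) ^ 3) ^ lam * ((κ * t) ^ (lam / α) * r ^ (-(lam / α))) := by
                  rw [Real.div_rpow (by positivity) hu0.le, div_eq_mul_inv]
                  congr 1
                  simp only [hu]
                  rw [← Real.rpow_mul (by positivity), ← Real.inv_rpow (by positivity), inv_div,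
                    Real.div_rpow hb.le hr.le, Real.rpow_neg hr.le, div_eq_mul_inv,
                    one_div_mul_eq_div]
              _ ≤ D * r ^ (-(lam / α)) := by
                  rw [hD, mul_assoc]
                  have : 0 ≤ lam / α := by positivity
                  gcongr
          · have hzS : (z, r) ∉ S := fun h => hz ((le_div_iff₀ hu0).2 h)
            simp [hH, indicator_of_notMem hzS]
        refine (lintegral_mono hpt).trans ?_
        rw [lintegral_const_mul _ (measurable_one.indicator hball), lintegral_indicator_one hball]
        have hMr : ballVol μ (p * u r) * ballVol μ (p ^ 3 / u r) ≤ M :=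
          hM _ _ (by positivity) (by positivity) (le_of_eq (by field_simp))
        rw [ENNReal.ofReal_mul (Real.exp_pos _).le, ← hW]
        calc _ = (ballVol μ (p * u r) * ballVol μ (p ^ 3 / u r)) *
              (ENNReal.ofReal (Real.exp (-r)) * W) := by rw [ballVol, ballVol]; ring
          _ ≤ _ := mul_le_mul_left hMr _
    _ = M * ∫⁻ r in Ioi (0 : ℝ),
          ENNReal.ofReal (Real.exp (-r) * (1 + D * r ^ (-(lam / α)))) :=
        lintegral_const_mul' _ _ ENNReal.coe_ne_top

lemma one_add_rpow_norm_sub_le {lam : ℝ} (hlam : 0 ≤ lam) (x z : V p) :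
    1 + ‖x - z‖ ^ (2 * lam) ≤ (1 + ‖x‖ ^ (2 * lam)) * (1 + ‖z‖ ^ (2 * lam)) := by
  have h1 : ‖x - z‖ ≤ max ‖x‖ ‖z‖ := by
    refine (pi_norm_le_iff_of_nonneg (by positivity)).2 fun i => ?_
    rw [Pi.sub_apply, sub_eq_add_neg]
    refine (IsUltrametricDist.norm_add_le_max (x i) (-z i)).trans ?_
    rw [norm_neg]
    exact max_le_max (norm_le_pi_norm x i) (norm_le_pi_norm z i)
  have hx : 0 ≤ ‖x‖ ^ (2 * lam) := by positivity
  have hz : 0 ≤ ‖z‖ ^ (2 * lam) := by positivity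
  have h2 : ‖x - z‖ ^ (2 * lam) ≤ ‖x‖ ^ (2 * lam) + ‖z‖ ^ (2 * lam) := by
    have h3 : ‖x - z‖ ^ (2 * lam) ≤ (max ‖x‖ ‖z‖) ^ (2 * lam) := by gcongr
    rcases max_choice ‖x‖ ‖z‖ with h | h <;> rw [h] at h3 <;> linarith
  nlinarith [mul_nonneg hx hz]

lemma norm_integral_heatZ_mul_le (μ : Measure (V p)) [μ.IsAddHaarMeasure] {χ : ℚ_[p] → ℂ} {a : ℤ}
    {κ α lam t C : ℝ} (hlam0 : 0 ≤ lam) {K : ENNReal} (hK : K < ⊤)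
    (hZ : ∫⁻ z, ‖heatZ p μ χ a κ α z t‖ₑ * ENNReal.ofReal (1 + ‖z‖ ^ (2 * lam)) ∂μ ≤ K)
    (hC : 0 ≤ C) {φ : V p → ℂ} (hφ : ∀ x, ‖φ x‖ ≤ C * (1 + ‖x‖ ^ (2 * lam))) (x : V p) :
    ‖∫ z, heatZ p μ χ a κ α z t * φ (x - z) ∂μ‖ ≤
      C * K.toReal * (1 + ‖x‖ ^ (2 * lam)) := by
  set A : ℝ := C * (1 + ‖x‖ ^ (2 * lam)) with hA
  have hA0 : 0 ≤ A := by positivity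
  have h1 : ‖∫ z, heatZ p μ χ a κ α z t * φ (x - z) ∂μ‖ₑ ≤ ENNReal.ofReal A * K := by
    refine (enorm_integral_le_lintegral_enorm _).trans ?_
    refine le_trans ?_ (mul_le_mul_right hZ _)
    rw [← lintegral_const_mul' _ _ ENNReal.ofReal_ne_top]
    refine lintegral_mono fun z => ?_
    rw [enorm_mul, mul_left_comm, ← ENNReal.ofReal_mul hA0]
    refine mul_le_mul_right ?_ _
    rw [← ofReal_norm]
    refine ENNReal.ofReal_le_ofReal ((hφ _).trans ?_)
    rw [hA, mul_assoc]
    exact mul_le_mul_of_nonneg_left (one_add_rpow_norm_sub_le hlam0 x z) hC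
  have h2 := ENNReal.toReal_mono (ENNReal.mul_ne_top ENNReal.ofReal_ne_top hK.ne) h1
  rw [toReal_enorm, ENNReal.toReal_mul, ENNReal.toReal_ofReal hA0] at h2
  exact h2.trans_eq (by rw [hA]; ring)

lemma heatPot2_eq (μ : Measure (V p)) [μ.IsAddHaarMeasure] (χ : ℚ_[p] → ℂ) (a : ℤ) (κ α : ℝ)
    (g : V p → ℝ → ℂ) (x : V p) (t τ : ℝ) :
    heatPot2 p μ χ a κ α g x t τ =
      ∫ θ in τ..t, ∫ z, heatZ p μ χ a κ α z (t - θ) * g (x - z) θ ∂μ := by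
  rw [heatPot2]
  congr 1
  funext θ
  rw [← integral_sub_left_eq_self _ μ x]
  simp only [sub_sub_cancel]

variable (p)

/-- for `0 ≤ λ < α` and `g(·,θ) ∈ 𝔐_{2λ}` uniformly in `θ`, the heat potential
`u₂` belongs to `𝔐_{2λ}` uniformly in `t, τ`; it has the same exponent of local constancy
as `g` and satisfies `|u₂(x,t,τ)| ≤ C₀ (1 + ‖x‖_p^{2λ})` with `C₀` independent of `t, τ`. -/
theorem statement14
    (hp : p ≠ 2) (a : ℤ) (ha : IsQNR p a)
    (μ : Measure (V p)) [μ.IsAddHaarMeasure] (hμ : μ {x : V p | ‖x‖ ≤ 1} = 1)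
    (χ : ℚ_[p] → ℂ) (hχ : IsStdChar p χ)
    (κ α lam T : ℝ) (hκ : 0 < κ) (hα : 0 < α) (hlam0 : 0 ≤ lam) (hlam : lam < α)
    (hT : 0 < T)
    (g : V p → ℝ → ℂ) (C δ : ℝ) (hδ : 0 < δ)
    (hgb : ∀ θ ∈ Icc (0 : ℝ) T, ∀ x : V p, ‖g x θ‖ ≤ C * (1 + ‖x‖ ^ (2 * lam)))
    (hglc : ∀ θ ∈ Icc (0 : ℝ) T, ∀ x y : V p, ‖x - y‖ ≤ δ → g x θ = g y θ) :
    (∀ t τ : ℝ, 0 ≤ τ → τ < t → t ≤ T → ∀ x y : V p, ‖x - y‖ ≤ δ →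
      heatPot2 p μ χ a κ α g x t τ = heatPot2 p μ χ a κ α g y t τ) ∧
    ∃ C₀ : ℝ, ∀ t τ : ℝ, 0 ≤ τ → τ < t → t ≤ T → ∀ x : V p,
      ‖heatPot2 p μ χ a κ α g x t τ‖ ≤ C₀ * (1 + ‖x‖ ^ (2 * lam)) := by
  constructor
  · intro t τ hτ hτt htT x y hxy
    rw [heatPot2_eq, heatPot2_eq]
    refine intervalIntegral.integral_congr fun θ hθ => ?_
    rw [uIcc_of_le hτt.le] at hθ
    refine integral_congr_ae (Eventually.of_forall fun z => ?_)
    simp only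
    rw [hglc θ ⟨hτ.trans hθ.1, hθ.2.trans htT⟩ (x - z) (y - z) (by rwa [sub_sub_sub_cancel_right])]
  · have hC : 0 ≤ C := by
      have h := (norm_nonneg _).trans (hgb 0 ⟨le_rfl, hT.le⟩ 0)
      exact nonneg_of_mul_nonneg_left h (by positivity)
    obtain ⟨K, hK, hZ⟩ := exists_lintegral_heatZ_le ha μ hμ hχ (T := T) hκ hα hlam0 hlam
    refine ⟨C * K.toReal * T, fun t τ hτ hτt htT x => ?_⟩
    rw [heatPot2_eq]
    have hne : ∀ᵐ θ : ℝ, θ ≠ t := by simp [ae_iff]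
    refine (intervalIntegral.norm_integral_le_of_norm_le_const_ae
      (C := C * K.toReal * (1 + ‖x‖ ^ (2 * lam))) ?_).trans ?_
    · filter_upwards [hne] with θ hθt hθ
      rw [uIoc_of_le hτt.le] at hθ
      have hlt : θ < t := lt_of_le_of_ne hθ.2 hθt
      exact norm_integral_heatZ_mul_le μ hlam0 hK
        (hZ (t - θ) (sub_pos.2 hlt) (by linarith [hθ.1])) hC
        (hgb θ ⟨hτ.trans hθ.1.le, hθ.2.trans htT⟩) x
    · rw [abs_of_pos (sub_pos.2 hτt)]
      have h0 : 0 ≤ C * K.toReal * (1 + ‖x‖ ^ (2 * lam)) := by positivity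
      calc _ ≤ C * K.toReal * (1 + ‖x‖ ^ (2 * lam)) * T :=
            mul_le_mul_of_nonneg_left (by linarith) h0
        _ = _ := by ring

end PadicParabolic
end
end
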